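/- MCP to CD: let (X,d,m) be a metric measure space that supports interpolation inequalities for densities with dimensional parameter n ∈ [1,∞), and let G be a gauge function on X. Assume: (a) each optimal dynamical plan ν occurring in the interpolation property is concentrated on a set of geodesics γ such that both (γ_0,γ_1) and (γ_1,γ_0) are continuity points of G; (b) (X,d,m,G) satisfies MCP(β) for a distortion coefficient β as in the context, whose parameter N satisfies N ≥ n. Then (X,d,m,G) satisfies CD(β,n). -/

import Mathlib

open MeasureTheory Filter Set Metric ENNReal Topology

noncomputable section

namespace GMMS

variable {X : Type*}

open Classical in
/-- The support of a Borel measure on a metric space: points all of whose balls have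
positive measure. -/
def mSupp [PseudoMetricSpace X] [MeasurableSpace X] (m : Measure X) : Set X :=
  {x : X | ∀ r : ℝ, 0 < r → 0 < m (Metric.ball x r)}

/-- A measure which is finite on every bounded set. -/
def FiniteOnBounded [PseudoMetricSpace X] [MeasurableSpace X] (m : Measure X) : Prop :=
  ∀ s : Set X, Bornology.IsBounded s → m s < ⊤

open Classical in
/-- The nonnegative part of an extended real number, in `[0,∞]`. -/
def epos (x : EReal) : ℝ≥0∞ := if x = ⊤ then ⊤ else ENNReal.ofReal x.toReal

/-- Integral of an `EReal`-valued function, defined as the difference of the lower integrals of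
the positive and negative parts (with the `EReal` convention `⊤ - ⊤ = ⊥`). -/
def eintegral {α : Type*} [MeasurableSpace α] (ν : Measure α) (f : α → EReal) : EReal :=
  ((∫⁻ a, epos (f a) ∂ν : ℝ≥0∞) : EReal) - ((∫⁻ a, epos (-(f a)) ∂ν : ℝ≥0∞) : EReal)

/-- `𝒟 = inf {θ > 0 | s θ = 0} ∈ (0,+∞]`. -/
def Dcal (s : ℝ → ℝ) : ℝ≥0∞ :=
  sInf (ENNReal.ofReal '' {θ : ℝ | 0 < θ ∧ s θ = 0})

/-- The distortion coefficient `β` associated with the data `(s, N)`: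
`β t 0 = t ^ N`, `β t θ = s (t θ) / s θ` for `0 < θ < 𝒟`, and
`β t θ = liminf_{φ → 𝒟⁻} s (t φ) / s φ` for `θ ≥ 𝒟`. -/
def beta (s : ℝ → ℝ) (N : ℝ) (t : ℝ) (θ : ℝ≥0∞) : ℝ≥0∞ :=
  if θ = 0 then ENNReal.ofReal (t ^ N)
  else if θ < Dcal s then ENNReal.ofReal (s (t * θ.toReal) / s θ.toReal)
  else Filter.liminf (fun φ : ℝ≥0∞ => ENNReal.ofReal (s (t * φ.toReal) / s φ.toReal))
      (nhdsWithin (Dcal s) (Set.Iio (Dcal s)))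

open Classical in
/-- The data `(s, N)` defining a distortion coefficient: `N ∈ [1,∞)`, `s` continuous on `[0,∞)`
with `s θ = c θ^N + o(θ^N)` as `θ → 0⁺`, for some `c > 0`. -/
structure DistortionData (s : ℝ → ℝ) (N : ℝ) : Prop where
  one_le : 1 ≤ N
  cont : ContinuousOn s (Set.Ici 0)
  asymp : ∃ c : ℝ, 0 < c ∧
    (fun θ : ℝ => s θ - c * θ ^ N) =o[nhdsWithin 0 (Set.Ioi 0)] (fun θ : ℝ => θ ^ N)

/-- The space of (constant-speed, defined on `[0,1]`) geodesics of a metric space. -/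
abbrev GeoSpace (X : Type*) [MetricSpace X] : Type _ :=
  {γ : C(unitInterval, X) //
    ∀ s t : unitInterval, dist (γ s) (γ t) = |(s : ℝ) - (t : ℝ)| * dist (γ 0) (γ 1)}

instance [MetricSpace X] : MeasurableSpace (GeoSpace X) := borel _

/-- Evaluation of a geodesic at time `t ∈ [0,1]`. -/
def geval [MetricSpace X] (γ : GeoSpace X) (t : ℝ) : X :=
  γ.1 (Set.projIcc 0 1 zero_le_one t)

/-- The squared quadratic Kantorovich-Rubinstein-Wasserstein transportation cost. -/
def W2sq [MetricSpace X] [MeasurableSpace X] (μ ν : Measure X) : ℝ≥0∞ :=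
  ⨅ (π : Measure (X × X)) (_ : π.map Prod.fst = μ) (_ : π.map Prod.snd = ν),
    ∫⁻ p, edist p.1 p.2 ^ 2 ∂π

/-- A `W₂`-geodesic: a curve of probability measures with finite second moment such that
`W₂(μ_s, μ_t) = |s - t| W₂(μ_0, μ_1)`. -/
structure IsW2Geo [MetricSpace X] [MeasurableSpace X] (μ : ℝ → Measure X) : Prop where
  prob : ∀ t ∈ Set.Icc (0:ℝ) 1, IsProbabilityMeasure (μ t)
  moment : ∀ t ∈ Set.Icc (0:ℝ) 1, ∃ x₀ : X, ∫⁻ x, edist x x₀ ^ 2 ∂(μ t) < ⊤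
  geo : ∀ s ∈ Set.Icc (0:ℝ) 1, ∀ t ∈ Set.Icc (0:ℝ) 1,
    W2sq (μ s) (μ t) = ENNReal.ofReal ((s - t) ^ 2) * W2sq (μ 0) (μ 1)

/-- Optimal dynamical plans from `μ0` to `μ1`. -/
def OptGeoSet [MetricSpace X] [MeasurableSpace X] (μ0 μ1 : Measure X) :
    Set (Measure (GeoSpace X)) :=
  {ν | IsProbabilityMeasure ν ∧
    (ν.map fun γ => (geval γ 0, geval γ 1)).map Prod.fst = μ0 ∧
    (ν.map fun γ => (geval γ 0, geval γ 1)).map Prod.snd = μ1 ∧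
    ∫⁻ p, edist p.1 p.2 ^ 2 ∂(ν.map fun γ => (geval γ 0, geval γ 1)) = W2sq μ0 μ1}

open Classical in
/-- The Boltzmann-Shannon relative entropy `Ent(μ|m) = ∫ ρ log ρ dm` if `μ = ρ m` with
`ρ log ρ ∈ L¹(m)`, and `+∞` otherwise. -/
def Ent [MeasurableSpace X] (μ m : Measure X) : EReal :=
  if μ ≪ m ∧
      Integrable (fun x => (μ.rnDeriv m x).toReal * Real.log (μ.rnDeriv m x).toReal) m
  then ((∫ x, (μ.rnDeriv m x).toReal * Real.log (μ.rnDeriv m x).toReal ∂m : ℝ) : EReal)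
  else (⊤ : EReal)

/-- The dimensional entropy `U_n(μ|m) = exp (-Ent(μ|m)/n)`, with value `0` when
`Ent(μ|m) = +∞`. -/
def UnE [MeasurableSpace X] (n : ℝ) (μ m : Measure X) : ℝ≥0∞ :=
  EReal.exp (((n⁻¹ : ℝ) : EReal) * (-(Ent μ m)))

/-- Probability measures with bounded support contained in `supp m`. -/
def Pbs [MetricSpace X] [MeasurableSpace X] (m : Measure X) : Set (Measure X) :=
  {μ | IsProbabilityMeasure μ ∧ Bornology.IsBounded (mSupp μ) ∧ mSupp μ ⊆ mSupp m}

/-- Probability measures with bounded support contained in `supp m` and finite entropy. -/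
def PbsStar [MetricSpace X] [MeasurableSpace X] (m : Measure X) : Set (Measure X) :=
  {μ | μ ∈ Pbs m ∧ Ent μ m ≠ ⊤}

/-- The coefficient `exp ((1/n) ∫ log (f γ) dν(γ))` appearing in the `CD(β,n)` inequality. -/
def cdCoeff [MetricSpace X] (n : ℝ) (ν : Measure (GeoSpace X)) (f : GeoSpace X → ℝ≥0∞) :
    ℝ≥0∞ :=
  EReal.exp (((n⁻¹ : ℝ) : EReal) * eintegral ν fun γ => ENNReal.log (f γ))

/-- The `CD` convexity inequality along the dynamical plan `ν`, for a coefficient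
`b : [0,1] × [0,∞] → [0,∞]` (with the conventions `∞ ⬝ 0 = 0` of `ℝ≥0∞`). -/
def CDineq [MetricSpace X] [MeasurableSpace X] (m : Measure X) (G : X → X → ℝ≥0∞)
    (b : ℝ → ℝ≥0∞ → ℝ≥0∞) (n : ℝ) (μ0 μ1 : Measure X) (ν : Measure (GeoSpace X)) : Prop :=
  ∀ t ∈ Set.Ioo (0:ℝ) 1,
    cdCoeff n ν (fun γ => b (1 - t) (G (geval γ 1) (geval γ 0))) * UnE n μ0 m
      + cdCoeff n ν (fun γ => b t (G (geval γ 0) (geval γ 1))) * UnE n μ1 m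
      ≤ UnE n (ν.map fun γ => geval γ t) m

/-- The curvature-dimension condition `CD(b, n)` for the gauge metric measure space
`(X, d, m, G)`. -/
def CD [MetricSpace X] [MeasurableSpace X] (m : Measure X) (G : X → X → ℝ≥0∞)
    (b : ℝ → ℝ≥0∞ → ℝ≥0∞) (n : ℝ) : Prop :=
  ∀ μ0 ∈ Pbs m, ∀ μ1 ∈ PbsStar m, mSupp μ0 ∩ mSupp μ1 = ∅ →
    ∃ ν ∈ OptGeoSet μ0 μ1, CDineq m G b n μ0 μ1 ν

/-- The strong curvature-dimension condition: the `CD` inequality holds along every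
optimal dynamical plan. -/
def CDStrong [MetricSpace X] [MeasurableSpace X] (m : Measure X) (G : X → X → ℝ≥0∞)
    (b : ℝ → ℝ≥0∞ → ℝ≥0∞) (n : ℝ) : Prop :=
  ∀ μ0 ∈ Pbs m, ∀ μ1 ∈ PbsStar m, mSupp μ0 ∩ mSupp μ1 = ∅ →
    ∀ ν ∈ OptGeoSet μ0 μ1, CDineq m G b n μ0 μ1 ν

/-- The measure contraction property `MCP(b)` for the gauge metric measure space
`(X, d, m, G)`. -/
def MCP [MetricSpace X] [MeasurableSpace X] (m : Measure X) (G : X → X → ℝ≥0∞)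
    (b : ℝ → ℝ≥0∞ → ℝ≥0∞) : Prop :=
  ∀ x ∈ mSupp m, ∀ μ1 ∈ PbsStar m, x ∉ mSupp μ1 →
    ∃ μ : ℝ → Measure X, IsW2Geo μ ∧ μ 0 = Measure.dirac x ∧ μ 1 = μ1 ∧
      ∀ t ∈ Set.Ioo (0:ℝ) 1, ∀ n : ℝ, 1 ≤ n →
        EReal.exp (((n⁻¹ : ℝ) : EReal) * eintegral μ1 fun y => ENNReal.log (b t (G x y)))
            * UnE n μ1 m
          ≤ UnE n (μ t) m

/-- The set of `t`-intermediate points between `A0` and `A1`. -/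
def Zt [MetricSpace X] (t : ℝ) (A0 A1 : Set X) : Set X :=
  {x | ∃ γ : GeoSpace X, geval γ 0 ∈ A0 ∧ geval γ 1 ∈ A1 ∧ geval γ t = x}

/-- The distortion coefficient `β_t(A0, A1)` between two sets. -/
def betaSet [MetricSpace X] [MeasurableSpace X] (m : Measure X) (G : X → X → ℝ≥0∞)
    (b : ℝ≥0∞ → ℝ≥0∞) (A0 A1 : Set X) : ℝ≥0∞ :=
  ⨆ (A0' : Set X) (_ : A0' ⊆ A0) (_ : A0'.Nonempty) (_ : m (A0 \ A0') = 0)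
    (A1' : Set X) (_ : A1' ⊆ A1) (_ : A1'.Nonempty) (_ : m (A1 \ A1') = 0),
    ⨅ (x0 : X) (_ : x0 ∈ A0' ∩ mSupp m) (x1 : X) (_ : x1 ∈ A1' ∩ mSupp m), b (G x0 x1)

/-- The "true" distortion coefficient of a metric measure space. -/
def trueBeta [MetricSpace X] [MeasurableSpace X] (m : Measure X) (t : ℝ) (x y : X) : ℝ≥0∞ :=
  Filter.limsup (fun r : ℝ => m (Zt t {x} (Metric.ball y r)) / m (Metric.ball y r))
    (nhdsWithin 0 (Set.Ioi 0))

/-- The `G`-diameter of a set. -/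
def diamG [MetricSpace X] [MeasurableSpace X] (m : Measure X) (G : X → X → ℝ≥0∞)
    (S : Set X) : ℝ≥0∞ :=
  ⨆ x ∈ S, essSup (fun y => G x y) (m.restrict (S \ {x}))

/-- The quantity `C_σ(x)` entering the definition of the geodesic dimension. -/
def Csig [MetricSpace X] [MeasurableSpace X] (m : Measure X) (σ : ℝ) (x : X) : ℝ≥0∞ :=
  ⨆ (A : Set X) (_ : MeasurableSet A) (_ : Bornology.IsBounded A) (_ : x ∉ A)
    (_ : 0 < m A) (_ : m A < ⊤),
    Filter.limsup (fun t : ℝ => ENNReal.ofReal (t ^ (-σ)) * m (Zt t {x} A) / m A)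
      (nhdsWithin 0 (Set.Ioi 0))

/-- The geodesic dimension at a point. -/
def dimGeo [MetricSpace X] [MeasurableSpace X] (m : Measure X) (x : X) : ℝ≥0∞ :=
  sInf (ENNReal.ofReal '' {σ : ℝ | 0 < σ ∧ Csig m σ x = ⊤})

/-- The geodesic dimension of a set. -/
def dimGeoS [MetricSpace X] [MeasurableSpace X] (m : Measure X) (S : Set X) : ℝ≥0∞ :=
  ⨆ x ∈ S, dimGeo m x

/-- The gauge `G` is meek. -/
def Meek [MetricSpace X] [MeasurableSpace X] (m : Measure X) (G : X → X → ℝ≥0∞) : Prop :=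
  ∀ x ∈ mSupp m, ∀ μ1 ∈ PbsStar m, x ∉ mSupp μ1 →
    ∀ ν ∈ OptGeoSet (Measure.dirac x) μ1,
      ∃ Γ : Set (GeoSpace X), MeasurableSet Γ ∧ ν Γ = 1 ∧
        ∀ γ ∈ Γ, ∀ t ∈ Set.Ioc (0:ℝ) 1,
          G (geval γ 0) (geval γ t) = ENNReal.ofReal t * G (geval γ 0) (geval γ 1)

/-- The measure `v_G(x₀, r, ρ)` of the intersection of a gauge sublevel set with a metric
ball. -/
def vG [MetricSpace X] [MeasurableSpace X] (m : Measure X) (G : X → X → ℝ≥0∞)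
    (x0 : X) (r ρ : ℝ) : ℝ≥0∞ :=
  m {x | G x0 x ≤ ENNReal.ofReal r ∧ dist x0 x ≤ ρ}

/-- `(supp m, d)` is a geodesic space: any two points of the support are joined by a geodesic
contained in the support. -/
def GeodesicSupp [MetricSpace X] [MeasurableSpace X] (m : Measure X) : Prop :=
  ∀ x ∈ mSupp m, ∀ y ∈ mSupp m, ∃ γ : GeoSpace X,
    geval γ 0 = x ∧ geval γ 1 = y ∧ ∀ t ∈ Set.Icc (0:ℝ) 1, geval γ t ∈ mSupp m

/-- An optimal dynamical plan realizing the interpolation inequality for densities with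
dimensional parameter `n` (the first right-hand term is omitted when `μ0` is not absolutely
continuous with respect to `m`). -/
def IsInterpPlan {X : Type*} [MetricSpace X] [MeasurableSpace X] (m : Measure X) (n : ℝ)
    (μ0 μ1 : Measure X) (ν : Measure (GeoSpace X)) : Prop :=
  ν ∈ OptGeoSet μ0 μ1 ∧
  (∀ t ∈ Set.Ioc (0:ℝ) 1, (ν.map fun γ => geval γ t) ≪ m) ∧
  ∀ t ∈ Set.Ioo (0:ℝ) 1, ∀ᵐ γ ∂ν,
    (μ0 ≪ m →
      trueBeta m (1 - t) (geval γ 1) (geval γ 0) ^ (1 / n)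
          * μ0.rnDeriv m (geval γ 0) ^ (-(1 / n))
        + trueBeta m t (geval γ 0) (geval γ 1) ^ (1 / n)
          * μ1.rnDeriv m (geval γ 1) ^ (-(1 / n))
        ≤ (ν.map fun γ' => geval γ' t).rnDeriv m (geval γ t) ^ (-(1 / n))) ∧
    (¬ μ0 ≪ m →
      trueBeta m t (geval γ 0) (geval γ 1) ^ (1 / n)
          * μ1.rnDeriv m (geval γ 1) ^ (-(1 / n))
        ≤ (ν.map fun γ' => geval γ' t).rnDeriv m (geval γ t) ^ (-(1 / n)))

/-- `(X,d,m)` supports interpolation inequalities for densities, with dimensional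
parameter `n`. -/
def SupportsInterp {X : Type*} [MetricSpace X] [MeasurableSpace X] (m : Measure X)
    (n : ℝ) : Prop :=
  ∀ μ0 ∈ Pbs m, ∀ μ1 ∈ PbsStar m, mSupp μ0 ∩ mSupp μ1 = ∅ →
    ∃ ν : Measure (GeoSpace X), IsInterpPlan m n μ0 μ1 ν

section Distortion

theorem DistortionData.tendsto_div {s : ℝ → ℝ} {N : ℝ} (h : DistortionData s N) :
    ∃ c : ℝ, 0 < c ∧ Tendsto (fun θ : ℝ => s θ / θ ^ N) (𝓝[>] 0) (𝓝 c) := by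
  obtain ⟨c, hc, ho⟩ := h.asymp
  refine ⟨c, hc, ?_⟩
  have h1 := ho.tendsto_div_nhds_zero
  have h2 := h1.add_const c
  rw [zero_add] at h2
  refine h2.congr' ?_
  filter_upwards [self_mem_nhdsWithin] with θ hθ
  have : θ ^ N ≠ 0 := (Real.rpow_pos_of_pos hθ N).ne'
  field_simp
  ring

theorem DistortionData.tendsto_ratio {s : ℝ → ℝ} {N : ℝ} (h : DistortionData s N) {t : ℝ}
    (ht : 0 < t) : Tendsto (fun θ : ℝ => s (t * θ) / s θ) (𝓝[>] 0) (𝓝 (t ^ N)) := by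
  obtain ⟨c, hc, hlim⟩ := h.tendsto_div
  have hscale : Tendsto (fun θ : ℝ => t * θ) (𝓝[>] 0) (𝓝[>] 0) := by
    refine tendsto_nhdsWithin_iff.2 ⟨?_, ?_⟩
    · have : Tendsto (fun θ : ℝ => t * θ) (𝓝 0) (𝓝 (t * 0)) := by
        exact (continuous_const.mul continuous_id).tendsto 0
      rw [mul_zero] at this
      exact this.mono_left nhdsWithin_le_nhds
    · filter_upwards [self_mem_nhdsWithin] with θ hθ using mul_pos ht hθ
  have h1 := ((hlim.comp hscale).div hlim hc.ne').const_mul (t ^ N)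
  rw [div_self hc.ne', mul_one] at h1
  refine h1.congr' ?_
  filter_upwards [self_mem_nhdsWithin] with θ hθ
  have hθ' : (0 : ℝ) < θ := hθ
  have e1 : θ ^ N ≠ 0 := (Real.rpow_pos_of_pos hθ' N).ne'
  have e2 : t ^ N ≠ 0 := (Real.rpow_pos_of_pos ht N).ne'
  simp only [Function.comp_apply, Pi.div_apply]
  rw [Real.mul_rpow ht.le hθ'.le]
  field_simp

theorem DistortionData.Dcal_pos {s : ℝ → ℝ} {N : ℝ} (h : DistortionData s N) : 0 < Dcal s := by
  obtain ⟨c, hc, hlim⟩ := h.tendsto_div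
  have hev : ∀ᶠ θ in 𝓝[>] (0 : ℝ), 0 < s θ / θ ^ N := hlim.eventually (lt_mem_nhds hc)
  obtain ⟨ε, hε, hsub⟩ := mem_nhdsGT_iff_exists_Ioo_subset.1 hev
  have hε' : (0 : ℝ) < ε := hε
  refine lt_of_lt_of_le (ENNReal.ofReal_pos.2 hε') (le_sInf ?_)
  rintro _ ⟨θ, ⟨hθ, hsθ⟩, rfl⟩
  refine ENNReal.ofReal_le_ofReal ?_
  by_contra! hlt
  have := hsub ⟨hθ, hlt⟩
  simp [hsθ] at this

theorem ne_zero_of_lt_Dcal {s : ℝ → ℝ} {θ : ℝ} (hθ : 0 < θ) (h : ENNReal.ofReal θ < Dcal s) :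
    s θ ≠ 0 := fun h0 => absurd h (not_lt.2 (sInf_le ⟨θ, ⟨hθ, h0⟩, rfl⟩))

theorem DistortionData.continuousAt {s : ℝ → ℝ} {N : ℝ} (h : DistortionData s N) {θ : ℝ}
    (hθ : 0 < θ) : ContinuousAt s θ :=
  h.cont.continuousAt (Ici_mem_nhds hθ)

theorem DistortionData.lowerSemicontinuous_beta {s : ℝ → ℝ} {N : ℝ} (h : DistortionData s N)
    {t : ℝ} (ht : 0 < t) : LowerSemicontinuous (beta s N t) := by
  intro θ₀ c hc
  have hD := h.Dcal_pos
  rcases eq_or_ne θ₀ 0 with rfl | h0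
  · have hc' : c < ENNReal.ofReal (t ^ N) := by simpa [beta] using hc
    have h1 : Tendsto (fun θ : ℝ => ENNReal.ofReal (s (t * θ) / s θ)) (𝓝[>] 0)
        (𝓝 (ENNReal.ofReal (t ^ N))) :=
      ENNReal.tendsto_ofReal (h.tendsto_ratio ht)
    have h2 : ∀ᶠ θ in 𝓝[>] (0 : ℝ), c < ENNReal.ofReal (s (t * θ) / s θ) :=
      h1.eventually (lt_mem_nhds hc')
    rw [eventually_nhdsWithin_iff] at h2
    have h3 : Tendsto ENNReal.toReal (𝓝 0) (𝓝 0) := by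
      simpa using ENNReal.tendsto_toReal (a := 0) ENNReal.zero_ne_top
    filter_upwards [h3.eventually h2, gt_mem_nhds hD] with θ hθ hθD
    rcases eq_or_ne θ 0 with rfl | hne
    · exact hc
    · have : beta s N t θ = ENNReal.ofReal (s (t * θ.toReal) / s θ.toReal) := by
        simp [beta, hne, hθD]
      rw [this]
      exact hθ (ENNReal.toReal_pos hne (ne_top_of_lt hθD))
  rcases lt_or_ge θ₀ (Dcal s) with hlt | hge
  · have htop : θ₀ ≠ ⊤ := ne_top_of_lt hlt
    have hpos : 0 < θ₀.toReal := ENNReal.toReal_pos h0 htop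
    have hs0 : s θ₀.toReal ≠ 0 :=
      ne_zero_of_lt_Dcal hpos (by rwa [ENNReal.ofReal_toReal htop])
    have hr : ContinuousAt (fun θ : ℝ => s (t * θ) / s θ) θ₀.toReal := by
      refine ContinuousAt.div ?_ (h.continuousAt hpos) hs0
      exact ContinuousAt.comp (f := fun θ : ℝ => t * θ) (h.continuousAt (mul_pos ht hpos))
        (continuous_const.mul continuous_id).continuousAt
    have h1 : Tendsto (fun θ : ℝ≥0∞ => ENNReal.ofReal (s (t * θ.toReal) / s θ.toReal)) (𝓝 θ₀)
        (𝓝 (ENNReal.ofReal (s (t * θ₀.toReal) / s θ₀.toReal))) :=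
      ENNReal.tendsto_ofReal (hr.tendsto.comp (ENNReal.tendsto_toReal htop))
    have hc' : c < ENNReal.ofReal (s (t * θ₀.toReal) / s θ₀.toReal) := by
      simpa [beta, h0, hlt] using hc
    filter_upwards [h1.eventually (lt_mem_nhds hc'), gt_mem_nhds hlt,
      lt_mem_nhds (pos_iff_ne_zero.2 h0)] with θ hθ hθD hθ0
    simpa [beta, hθ0.ne', hθD] using hθ
  · have hc' : c < Filter.liminf
        (fun φ : ℝ≥0∞ => ENNReal.ofReal (s (t * φ.toReal) / s φ.toReal))
        (𝓝[<] (Dcal s)) := by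
      have hc2 := hc
      unfold beta at hc2
      rwa [if_neg h0, if_neg (not_lt.2 hge)] at hc2
    have hge_val : ∀ θ, Dcal s ≤ θ → c < beta s N t θ := by
      intro θ hθ
      unfold beta
      rwa [if_neg (hD.trans_le hθ).ne', if_neg (not_lt.2 hθ)]
    have hev := Filter.eventually_lt_of_lt_liminf hc'
    rw [eventually_nhdsWithin_iff] at hev
    rcases hge.eq_or_lt with heq | hgt
    · rw [← heq]
      filter_upwards [hev, lt_mem_nhds hD] with θ hθ hθ0
      rcases lt_or_ge θ (Dcal s) with hl | hl
      · have := hθ hl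
        simpa [beta, hθ0.ne', hl] using this
      · exact hge_val θ hl
    · filter_upwards [lt_mem_nhds hgt] with θ hθ using hge_val θ hθ.le

theorem DistortionData.measurable_beta {s : ℝ → ℝ} {N : ℝ} (h : DistortionData s N)
    {t : ℝ} (ht : 0 < t) : Measurable (beta s N t) :=
  (h.lowerSemicontinuous_beta ht).measurable

end Distortion

section ExtendedIntegral

theorem epos_mono : Monotone epos := by
  intro a b hab
  induction b with
  | top => simp [epos]
  | bot => simp [le_bot_iff.1 hab]
  | coe b =>
    induction a with
    | top => simp at hab
    | bot => simp [epos]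
    | coe a =>
      have h : a ≤ b := by exact_mod_cast hab
      simpa [epos] using ENNReal.ofReal_le_ofReal h

theorem epos_coe (x : ℝ) : epos (x : EReal) = ENNReal.ofReal x := by simp [epos]

theorem eintegral_mono_ae {α : Type*} [MeasurableSpace α] {ν : Measure α} {f g : α → EReal}
    (h : ∀ᵐ a ∂ν, f a ≤ g a) : eintegral ν f ≤ eintegral ν g := by
  unfold eintegral
  refine EReal.sub_le_sub ?_ ?_
  · exact_mod_cast lintegral_mono_ae (h.mono fun a ha => epos_mono ha)
  · exact_mod_cast lintegral_mono_ae (h.mono fun a ha => epos_mono (EReal.neg_le_neg_iff.2 ha))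

theorem eintegral_const {α : Type*} [MeasurableSpace α] (ν : Measure α) [IsProbabilityMeasure ν]
    (c : EReal) : eintegral ν (fun _ => c) = c := by
  induction c with
  | top => simp [eintegral, epos]
  | bot => simp [eintegral, epos]
  | coe c =>
    unfold eintegral
    simp only [← EReal.coe_neg, epos_coe, lintegral_const, measure_univ, mul_one]
    rw [EReal.coe_ennreal_ofReal, EReal.coe_ennreal_ofReal, ← EReal.coe_sub]
    congr 1
    exact max_zero_sub_eq_self c

theorem eintegral_coe {α : Type*} [MeasurableSpace α] {ν : Measure α} {f : α → ℝ}
    (hf : Integrable f ν) : eintegral ν (fun a => (f a : EReal)) = ((∫ a, f a ∂ν : ℝ) : EReal) := by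
  have h1 : ∫⁻ a, ENNReal.ofReal (f a) ∂ν ≠ ⊤ := hf.lintegral_lt_top.ne
  have h2 : ∫⁻ a, ENNReal.ofReal (-f a) ∂ν ≠ ⊤ := hf.neg.lintegral_lt_top.ne
  unfold eintegral
  simp only [← EReal.coe_neg, epos_coe]
  rw [integral_eq_lintegral_pos_part_sub_lintegral_neg_part hf, EReal.coe_sub,
    EReal.coe_ennreal_toReal h1, EReal.coe_ennreal_toReal h2]

end ExtendedIntegral

section Support

theorem mSupp_subset_of_ae [PseudoMetricSpace X] [MeasurableSpace X] {μ : Measure X} {C : Set X}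
    (hC : IsClosed C) (h : ∀ᵐ x ∂μ, x ∈ C) : mSupp μ ⊆ C := by
  intro z hz
  by_contra hzC
  obtain ⟨r, hr, hsub⟩ := Metric.isOpen_iff.1 hC.isOpen_compl z hzC
  exact (hz r hr).ne' (measure_mono_null hsub h)

theorem mSupp_subset_of_absolutelyContinuous [PseudoMetricSpace X] [MeasurableSpace X]
    {μ m : Measure X} (h : μ ≪ m) : mSupp μ ⊆ mSupp m := fun _ hz r hr =>
  pos_iff_ne_zero.2 fun h0 => (hz r hr).ne' (h h0)

theorem ae_mem_mSupp [PseudoMetricSpace X] [MeasurableSpace X] [SecondCountableTopology X]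
    (μ : Measure X) : ∀ᵐ x ∂μ, x ∈ mSupp μ := by
  refine measure_null_of_locally_null _ fun x hx => ?_
  have hx' : ∃ r : ℝ, 0 < r ∧ μ (Metric.ball x r) = 0 := by
    by_contra! hcon
    exact hx fun r hr => pos_iff_ne_zero.2 (hcon r hr)
  obtain ⟨r, hr, h0⟩ := hx'
  exact ⟨Metric.ball x r, mem_nhdsWithin_of_mem_nhds (Metric.ball_mem_nhds x hr), h0⟩

end Support

section Geodesics

variable [MetricSpace X]

instance : BorelSpace (GeoSpace X) := ⟨rfl⟩

theorem continuous_geval (t : ℝ) : Continuous fun γ : GeoSpace X => geval γ t :=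
  (continuous_eval_const _).comp continuous_subtype_val

theorem measurable_geval [MeasurableSpace X] [BorelSpace X] (t : ℝ) :
    Measurable fun γ : GeoSpace X => geval γ t :=
  (continuous_geval t).measurable

theorem measurable_geval_pair [MeasurableSpace X] [BorelSpace X] (s t : ℝ) :
    Measurable fun γ : GeoSpace X => (geval γ s, geval γ t) :=
  (measurable_geval s).prodMk (measurable_geval t)

theorem dist_geval (γ : GeoSpace X) {s t : ℝ} (hs : s ∈ Set.Icc (0 : ℝ) 1)
    (ht : t ∈ Set.Icc (0 : ℝ) 1) :
    dist (geval γ s) (geval γ t) = |s - t| * dist (geval γ 0) (geval γ 1) := by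
  have h := γ.2 ⟨s, hs⟩ ⟨t, ht⟩
  unfold geval
  rw [Set.projIcc_of_mem _ hs, Set.projIcc_of_mem _ ht, h, Set.projIcc_left, Set.projIcc_right]
  rfl

/-- A curve on `[0,1]` whose speed does not exceed the distance of its endpoints
is a geodesic. -/
theorem exists_geodesic_of_lipschitz (f : ℝ → X)
    (hf : ∀ s ∈ Set.Icc (0 : ℝ) 1, ∀ u ∈ Set.Icc (0 : ℝ) 1, s ≤ u →
      dist (f s) (f u) ≤ (u - s) * dist (f 0) (f 1)) :
    ∃ γ : GeoSpace X, ∀ s ∈ Set.Icc (0 : ℝ) 1, geval γ s = f s := by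
  have heq : ∀ s ∈ Set.Icc (0 : ℝ) 1, ∀ u ∈ Set.Icc (0 : ℝ) 1, s ≤ u →
      dist (f s) (f u) = |s - u| * dist (f 0) (f 1) := by
    intro s hs u hu hsu
    have h1 := hf 0 (by simp) s hs hs.1
    have h2 := hf s hs u hu hsu
    have h3 := hf u hu 1 (by simp) hu.2
    have h4 := dist_triangle4 (f 0) (f s) (f u) (f 1)
    rw [abs_sub_comm, abs_of_nonneg (sub_nonneg.2 hsu)]
    nlinarith
  have hall : ∀ s ∈ Set.Icc (0 : ℝ) 1, ∀ u ∈ Set.Icc (0 : ℝ) 1,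
      dist (f s) (f u) = |s - u| * dist (f 0) (f 1) := by
    intro s hs u hu
    rcases le_total s u with h | h
    · exact heq s hs u hu h
    · rw [dist_comm, abs_sub_comm]
      exact heq u hu s hs h
  have hcont : Continuous fun s : unitInterval => f s := by
    refine LipschitzWith.continuous (K := ⟨dist (f 0) (f 1), dist_nonneg⟩) ?_
    refine LipschitzWith.of_dist_le_mul fun s u => ?_
    rw [hall s s.2 u u.2, mul_comm]
    rfl
  refine ⟨⟨⟨fun s => f s, hcont⟩, fun s u => ?_⟩, fun s hs => ?_⟩
  · simpa using hall s s.2 u u.2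
  · simp [geval, Set.projIcc_of_mem _ hs]

theorem exists_geodesic_concat {t : ℝ} (ht : t ∈ Set.Ioo (0 : ℝ) 1) (γ₁ γ₂ : GeoSpace X)
    (hglue : geval γ₁ 1 = geval γ₂ 0)
    (h₁ : dist (geval γ₁ 0) (geval γ₁ 1) = t * dist (geval γ₁ 0) (geval γ₂ 1))
    (h₂ : dist (geval γ₂ 0) (geval γ₂ 1) = (1 - t) * dist (geval γ₁ 0) (geval γ₂ 1)) :
    ∃ γ : GeoSpace X, geval γ 0 = geval γ₁ 0 ∧ geval γ 1 = geval γ₂ 1 ∧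
      geval γ t = geval γ₁ 1 := by
  obtain ⟨ht0, ht1⟩ := ht
  have ht1' : 0 < 1 - t := by linarith
  set f : ℝ → X := fun s => if s ≤ t then geval γ₁ (s / t) else geval γ₂ ((s - t) / (1 - t))
    with hfdef
  have f0 : f 0 = geval γ₁ 0 := by simp [hfdef, ht0.le]
  have f1 : f 1 = geval γ₂ 1 := by simp [hfdef, ht1, div_self ht1'.ne']
  have ft : f t = geval γ₁ 1 := by simp [hfdef, div_self ht0.ne']
  set D := dist (geval γ₁ 0) (geval γ₂ 1) with hD
  have left : ∀ s ∈ Set.Icc (0 : ℝ) t, ∀ u ∈ Set.Icc (0 : ℝ) t, s ≤ u →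
      dist (f s) (f u) ≤ (u - s) * D := by
    intro s hs u hu hsu
    have e := dist_geval γ₁ (s := s / t) (t := u / t)
      ⟨div_nonneg hs.1 ht0.le, (div_le_one ht0).2 hs.2⟩
      ⟨div_nonneg hu.1 ht0.le, (div_le_one ht0).2 hu.2⟩
    have ef : dist (f s) (f u) = dist (geval γ₁ (s / t)) (geval γ₁ (u / t)) := by
      simp [hfdef, hs.2, hu.2]
    have ea : |s / t - u / t| = (u - s) / t := by
      rw [← sub_div, abs_div, abs_of_pos ht0, abs_sub_comm, abs_of_nonneg (sub_nonneg.2 hsu)]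
    rw [ef, e, h₁, ea]
    refine le_of_eq ?_
    field_simp
  have fr : ∀ s ∈ Set.Icc t 1, f s = geval γ₂ ((s - t) / (1 - t)) := by
    intro s hs
    rcases hs.1.eq_or_lt with rfl | h
    · rw [ft, hglue]; simp
    · simp [hfdef, not_le.2 h]
  have right : ∀ s ∈ Set.Icc t 1, ∀ u ∈ Set.Icc t 1, s ≤ u →
      dist (f s) (f u) ≤ (u - s) * D := by
    intro s hs u hu hsu
    have e := dist_geval γ₂ (s := (s - t) / (1 - t)) (t := (u - t) / (1 - t))
      ⟨div_nonneg (by linarith [hs.1]) ht1'.le, (div_le_one ht1').2 (by linarith [hs.2])⟩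
      ⟨div_nonneg (by linarith [hu.1]) ht1'.le, (div_le_one ht1').2 (by linarith [hu.2])⟩
    have ea : |(s - t) / (1 - t) - (u - t) / (1 - t)| = (u - s) / (1 - t) := by
      rw [← sub_div, abs_div, abs_of_pos ht1', abs_sub_comm, abs_of_nonneg (by linarith)]
      ring
    rw [fr s hs, fr u hu, e, h₂, ea]
    refine le_of_eq ?_
    field_simp
  obtain ⟨γ, hγ⟩ := exists_geodesic_of_lipschitz f (by
    intro s hs u hu hsu
    rw [f0, f1, ← hD]
    rcases le_total u t with hut | hut
    · exact left s ⟨hs.1, hsu.trans hut⟩ u ⟨hu.1, hut⟩ hsu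
    rcases le_total s t with hst | hst
    · have a := left s ⟨hs.1, hst⟩ t ⟨ht0.le, le_rfl⟩ hst
      have b := right t ⟨le_rfl, ht1.le⟩ u ⟨hut, hu.2⟩ hut
      have c := dist_triangle (f s) (f t) (f u)
      linarith
    · exact right s ⟨hst, hs.2⟩ u ⟨hut, hu.2⟩ hsu)
  exact ⟨γ, by rw [hγ 0 (by simp), f0], by rw [hγ 1 (by simp), f1],
    by rw [hγ t ⟨ht0.le, ht1.le⟩, ft]⟩

theorem isClosed_geodesics : IsClosed {γ : C(unitInterval, X) |
    ∀ s t : unitInterval, dist (γ s) (γ t) = |(s : ℝ) - (t : ℝ)| * dist (γ 0) (γ 1)} := by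
  simp only [Set.ofPred_forall]
  refine isClosed_iInter fun s => isClosed_iInter fun t => ?_
  exact isClosed_eq
    ((continuous_eval_const s).dist (continuous_eval_const t))
    (continuous_const.mul
      ((continuous_eval_const 0).dist (continuous_eval_const 1)))

/-- If `ν`-almost every geodesic has a property `P`, then almost every point for the law of
`e_t` is the value at time `t` of a geodesic with the property `P`. -/
theorem ae_exists_geodesic [MeasurableSpace X] [BorelSpace X] [CompleteSpace X]
    [SecondCountableTopology X] (ν : Measure (GeoSpace X)) [IsFiniteMeasure ν] (t : ℝ)
    {P : GeoSpace X → Prop} (hP : ∀ᵐ γ ∂ν, P γ) :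
    ∀ᵐ z ∂(ν.map fun γ => geval γ t), ∃ γ : GeoSpace X, P γ ∧ geval γ t = z := by
  have : CompleteSpace (GeoSpace X) := isClosed_geodesics.completeSpace_coe
  obtain ⟨Q, hQsub, hQm, hQ0⟩ := exists_measurable_superset_of_null hP
  have hfin : ν Qᶜ ≠ ⊤ := measure_ne_top _ _
  refine le_antisymm (ENNReal.le_of_forall_pos_le_add fun ε hε _ => ?_) zero_le
  obtain ⟨K, hKQ, hK, hKν⟩ := hQm.compl.exists_isCompact_lt_add hfin
    (ENNReal.coe_pos.2 hε).ne'
  have hKm : MeasurableSet ((fun γ : GeoSpace X => geval γ t) '' K) :=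
    (hK.image (continuous_geval t)).isClosed.measurableSet
  have hKmeas : MeasurableSet K := hK.isClosed.measurableSet
  calc (ν.map fun γ => geval γ t) {z | ∃ γ : GeoSpace X, P γ ∧ geval γ t = z}ᶜ
      ≤ (ν.map fun γ => geval γ t) ((fun γ : GeoSpace X => geval γ t) '' K)ᶜ := by
        refine measure_mono (Set.compl_subset_compl.2 ?_)
        rintro _ ⟨γ, hγ, rfl⟩
        refine ⟨γ, ?_, rfl⟩
        by_contra hn
        exact hKQ hγ (hQsub hn)
    _ = ν ((fun γ : GeoSpace X => geval γ t) ⁻¹' ((fun γ : GeoSpace X => geval γ t) '' K)ᶜ) :=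
        Measure.map_apply (measurable_geval t) hKm.compl
    _ ≤ ν Kᶜ := measure_mono fun γ hγ hγK => hγ ⟨γ, hγK, rfl⟩
    _ ≤ 0 + ε := by
        rw [zero_add]
        have h1 : ν Kᶜ ≤ ν (Qᶜ \ K) + ν Q := by
          refine (measure_mono ?_).trans (measure_union_le _ _)
          intro γ hγ
          by_cases hq : γ ∈ Q
          · exact Or.inr hq
          · exact Or.inl ⟨hq, hγ⟩
        rw [hQ0, add_zero, measure_sdiff hKQ hKmeas.nullMeasurableSet (measure_ne_top _ _)] at h1
        refine h1.trans ?_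
        rw [tsub_le_iff_left]
        exact hKν.le

end Geodesics

section Wasserstein

theorem ae_of_map_fst [MeasurableSpace X] {π : Measure (X × X)} {μ : Measure X}
    (h : π.map Prod.fst = μ)
    {P : X → Prop} (hP : ∀ᵐ z ∂μ, P z) : ∀ᵐ p ∂π, P p.1 := by
  subst h
  exact ae_of_ae_map measurable_fst.aemeasurable hP

theorem ae_of_map_snd [MeasurableSpace X] {π : Measure (X × X)} {μ : Measure X}
    (h : π.map Prod.snd = μ)
    {P : X → Prop} (hP : ∀ᵐ z ∂μ, P z) : ∀ᵐ p ∂π, P p.2 := by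
  subst h
  exact ae_of_ae_map measurable_snd.aemeasurable hP

theorem lintegral_map_fst [MeasurableSpace X] {π : Measure (X × X)} {μ : Measure X}
    (h : π.map Prod.fst = μ)
    {f : X → ℝ≥0∞} (hf : Measurable f) : ∫⁻ p, f p.1 ∂π = ∫⁻ z, f z ∂μ := by
  subst h
  rw [lintegral_map hf measurable_fst]

theorem lintegral_map_snd [MeasurableSpace X] {π : Measure (X × X)} {μ : Measure X}
    (h : π.map Prod.snd = μ)
    {f : X → ℝ≥0∞} (hf : Measurable f) : ∫⁻ p, f p.2 ∂π = ∫⁻ z, f z ∂μ := by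
  subst h
  rw [lintegral_map hf measurable_snd]

/-- The defect in the Minkowski inequality `d(x,y) ≤ d(x,z) + d(z,y)` along a coupling of the
intermediate law `z` with the final law `y`. -/
def defect [MetricSpace X] (x : X) (t : ℝ) (p : X × X) : ℝ :=
  ((1 - t) * dist x p.1 - t * dist p.1 p.2) ^ 2 / (t * (1 - t)) +
    (dist x p.1 + dist p.1 p.2 - dist x p.2) ^ 2

theorem defect_nonneg [MetricSpace X] (x : X) {t : ℝ} (ht : t ∈ Set.Ioo (0 : ℝ) 1) (p : X × X) :
    0 ≤ defect x t p := by
  have := mul_pos ht.1 (sub_pos.2 ht.2)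
  unfold defect
  positivity

theorem sq_dist_add_defect_le [MetricSpace X] (x : X) {t : ℝ} (ht : t ∈ Set.Ioo (0 : ℝ) 1)
    (p : X × X) :
    dist x p.2 ^ 2 + defect x t p ≤ t⁻¹ * dist x p.1 ^ 2 + (1 - t)⁻¹ * dist p.1 p.2 ^ 2 := by
  have h0 := ht.1
  have h1 : 0 < 1 - t := sub_pos.2 ht.2
  have htri := dist_triangle x p.1 p.2
  have hh : 0 ≤ dist x p.2 := dist_nonneg
  unfold defect
  set f := dist x p.1
  set g := dist p.1 p.2
  set h := dist x p.2
  have e : t⁻¹ * f ^ 2 + (1 - t)⁻¹ * g ^ 2 =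
      ((1 - t) * f - t * g) ^ 2 / (t * (1 - t)) + (f + g) ^ 2 := by
    field_simp
    ring
  rw [e]
  nlinarith

variable [MetricSpace X] [MeasurableSpace X] [BorelSpace X] [SecondCountableTopology X]

theorem measurable_edist_sq (x : X) : Measurable fun z : X => edist x z ^ 2 :=
  (measurable_const.edist measurable_id).pow_const 2

theorem W2sq_dirac (x : X) (μ : Measure X) [IsProbabilityMeasure μ] :
    W2sq (Measure.dirac x) μ = ∫⁻ z, edist x z ^ 2 ∂μ := by
  have key : ∀ π : Measure (X × X), π.map Prod.fst = Measure.dirac x → π.map Prod.snd = μ →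
      ∫⁻ p, edist p.1 p.2 ^ 2 ∂π = ∫⁻ z, edist x z ^ 2 ∂μ := by
    intro π h1 h2
    have hx : ∀ᵐ z ∂(Measure.dirac x), z = x := by
      rw [ae_dirac_eq]; rfl
    rw [← lintegral_map_snd h2 (measurable_edist_sq x)]
    refine lintegral_congr_ae ?_
    filter_upwards [ae_of_map_fst h1 hx] with p hp
    rw [hp]
  refine le_antisymm ?_ ?_
  · unfold W2sq
    refine iInf_le_of_le ((Measure.dirac x).prod μ) ?_
    have h1 : ((Measure.dirac x).prod μ).map Prod.fst = Measure.dirac x := by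
      rw [Measure.map_fst_prod]; simp
    have h2 : ((Measure.dirac x).prod μ).map Prod.snd = μ := by
      rw [Measure.map_snd_prod]; simp
    exact iInf_le_of_le h1 (iInf_le_of_le h2 (key _ h1 h2).le)
  · exact le_iInf fun π => le_iInf fun h1 => le_iInf fun h2 => (key π h1 h2).ge

theorem measurable_defect (x : X) (t : ℝ) : Measurable (defect x t) := by
  have h1 : Measurable fun p : X × X => dist x p.1 := measurable_const.dist measurable_fst
  have h2 : Measurable fun p : X × X => dist x p.2 := measurable_const.dist measurable_snd
  have h3 : Measurable fun p : X × X => dist p.1 p.2 := measurable_fst.dist measurable_snd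
  unfold defect
  fun_prop

theorem lintegral_defect_le {π : Measure (X × X)} {x : X} {t : ℝ} (ht : t ∈ Set.Ioo (0 : ℝ) 1)
    {A ε : ℝ≥0∞} (hA : A ≠ ⊤) (h1 : ∫⁻ p, edist x p.1 ^ 2 ∂π = ENNReal.ofReal (t ^ 2) * A)
    (h2 : ∫⁻ p, edist p.1 p.2 ^ 2 ∂π ≤ ENNReal.ofReal ((1 - t) ^ 2) * A + ε)
    (h3 : ∫⁻ p, edist x p.2 ^ 2 ∂π = A) :
    ∫⁻ p, ENNReal.ofReal (defect x t p) ∂π ≤ ENNReal.ofReal (1 - t)⁻¹ * ε := by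
  have ht0 := ht.1
  have ht1 : 0 < 1 - t := sub_pos.2 ht.2
  have sq : ∀ a b : X, edist a b ^ 2 = ENNReal.ofReal (dist a b ^ 2) := fun a b => by
    rw [edist_dist, ENNReal.ofReal_pow dist_nonneg]
  have pt : ∀ p : X × X, edist x p.2 ^ 2 + ENNReal.ofReal (defect x t p) ≤
      ENNReal.ofReal t⁻¹ * edist x p.1 ^ 2 + ENNReal.ofReal (1 - t)⁻¹ * edist p.1 p.2 ^ 2 := by
    intro p
    rw [sq, sq, sq, ← ENNReal.ofReal_mul (by positivity), ← ENNReal.ofReal_mul (by positivity),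
      ← ENNReal.ofReal_add (by positivity) (defect_nonneg x ht p),
      ← ENNReal.ofReal_add (by positivity) (by positivity)]
    exact ENNReal.ofReal_le_ofReal (sq_dist_add_defect_le x ht p)
  have m1 : Measurable fun p : X × X => edist x p.1 ^ 2 :=
    (measurable_edist_sq x).comp measurable_fst
  have m2 : Measurable fun p : X × X => edist x p.2 ^ 2 :=
    (measurable_edist_sq x).comp measurable_snd
  have m3 : Measurable fun p : X × X => edist p.1 p.2 ^ 2 :=
    (measurable_fst.edist measurable_snd).pow_const 2
  have hInt := lintegral_mono (μ := π) pt
  rw [lintegral_add_left m2, lintegral_add_left (m1.const_mul _), lintegral_const_mul _ m1,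
    lintegral_const_mul _ m3, h1, h3] at hInt
  have hle : A + ∫⁻ p, ENNReal.ofReal (defect x t p) ∂π ≤
      A + ENNReal.ofReal (1 - t)⁻¹ * ε := by
    refine hInt.trans ?_
    calc ENNReal.ofReal t⁻¹ * (ENNReal.ofReal (t ^ 2) * A) +
          ENNReal.ofReal (1 - t)⁻¹ * ∫⁻ p, edist p.1 p.2 ^ 2 ∂π
        ≤ ENNReal.ofReal t⁻¹ * (ENNReal.ofReal (t ^ 2) * A) +
          ENNReal.ofReal (1 - t)⁻¹ * (ENNReal.ofReal ((1 - t) ^ 2) * A + ε) := by gcongr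
      _ = (ENNReal.ofReal (t⁻¹ * t ^ 2) + ENNReal.ofReal ((1 - t)⁻¹ * (1 - t) ^ 2)) * A +
          ENNReal.ofReal (1 - t)⁻¹ * ε := by
        rw [ENNReal.ofReal_mul (by positivity), ENNReal.ofReal_mul (by positivity)]
        ring
      _ = A + ENNReal.ofReal (1 - t)⁻¹ * ε := by
        have e : t⁻¹ * t ^ 2 + (1 - t)⁻¹ * (1 - t) ^ 2 = 1 := by field_simp; ring
        rw [← ENNReal.ofReal_add (by positivity) (by positivity), e, ENNReal.ofReal_one, one_mul]
  exact (ENNReal.add_le_add_iff_left hA).1 hle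

/-- Along an optimal coupling of the intermediate law with the final law, almost every triple
`x, z, y` is aligned. -/
theorem ae_aligned {π : Measure (X × X)} {x : X} {t : ℝ} (ht : t ∈ Set.Ioo (0 : ℝ) 1)
    {A : ℝ≥0∞} (hA : A ≠ ⊤) (h1 : ∫⁻ p, edist x p.1 ^ 2 ∂π = ENNReal.ofReal (t ^ 2) * A)
    (h2 : ∫⁻ p, edist p.1 p.2 ^ 2 ∂π ≤ ENNReal.ofReal ((1 - t) ^ 2) * A)
    (h3 : ∫⁻ p, edist x p.2 ^ 2 ∂π = A) :
    ∀ᵐ p ∂π, dist x p.1 = t * dist x p.2 ∧ dist p.1 p.2 = (1 - t) * dist x p.2 := by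
  have h := lintegral_defect_le (ε := 0) ht hA h1 (by simpa using h2) h3
  rw [mul_zero, nonpos_iff_eq_zero,
    lintegral_eq_zero_iff (measurable_defect x t).ennreal_ofReal] at h
  filter_upwards [h] with p hp
  have hp' : defect x t p ≤ 0 := ENNReal.ofReal_eq_zero.1 hp
  have hpos := mul_pos ht.1 (sub_pos.2 ht.2)
  unfold defect at hp'
  have a1 : 0 ≤ ((1 - t) * dist x p.1 - t * dist p.1 p.2) ^ 2 / (t * (1 - t)) := by positivity
  have a2 := sq_nonneg (dist x p.1 + dist p.1 p.2 - dist x p.2)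
  have b1 : ((1 - t) * dist x p.1 - t * dist p.1 p.2) ^ 2 / (t * (1 - t)) = 0 := by linarith
  have b2 : dist x p.1 + dist p.1 p.2 - dist x p.2 = 0 :=
    pow_eq_zero_iff (two_ne_zero) |>.1 (by linarith)
  have b3 : (1 - t) * dist x p.1 - t * dist p.1 p.2 = 0 := by
    rcases div_eq_zero_iff.1 b1 with h | h
    · exact pow_eq_zero_iff (two_ne_zero) |>.1 h
    · exact absurd h hpos.ne'
  constructor <;> nlinarith

/-- Localization of the intermediate measures of a `W₂`-geodesic issuing from a Dirac mass. -/
theorem ae_abs_dist_sub_lt {μ₁ μ : Measure X} {x : X} {t d r η : ℝ} (ht : t ∈ Set.Ioo (0 : ℝ) 1)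
    (hA : ∫⁻ y, edist x y ^ 2 ∂μ₁ ≠ ⊤)
    (h1 : ∫⁻ z, edist x z ^ 2 ∂μ = ENNReal.ofReal (t ^ 2) * ∫⁻ y, edist x y ^ 2 ∂μ₁)
    (h2 : W2sq μ μ₁ = ENNReal.ofReal ((1 - t) ^ 2) * ∫⁻ y, edist x y ^ 2 ∂μ₁)
    (hsupp : ∀ᵐ y ∂μ₁, |dist x y - d| ≤ r) (hη : t * r < η) :
    ∀ᵐ z ∂μ, |dist x z - t * d| < η := by
  have ht0 := ht.1
  have ht1 : 0 < 1 - t := sub_pos.2 ht.2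
  set δ := η - t * r with hδ
  have hδpos : 0 < δ := sub_pos.2 hη
  set E : Set X := {z | η ≤ |dist x z - t * d|} with hE
  have hEm : MeasurableSet E := by
    refine measurableSet_le measurable_const ?_
    exact ((measurable_const.dist measurable_id).sub_const _).abs
  have hμE : μ E * ENNReal.ofReal (δ ^ 2) = 0 := by
    refine le_antisymm (ENNReal.le_of_forall_pos_le_add fun ε hε _ => ?_) zero_le
    set K : ℝ≥0∞ := 2 * ENNReal.ofReal (1 - t)⁻¹ with hK
    have hKtop : K ≠ ⊤ := ENNReal.mul_ne_top (by simp) ENNReal.ofReal_ne_top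
    have hK0 : K ≠ 0 := mul_ne_zero two_ne_zero (ENNReal.ofReal_pos.2 (by positivity)).ne'
    have hlt : W2sq μ μ₁ < ENNReal.ofReal ((1 - t) ^ 2) * ∫⁻ y, edist x y ^ 2 ∂μ₁ + ε / K := by
      rw [h2]
      refine ENNReal.lt_add_right (ENNReal.mul_ne_top ENNReal.ofReal_ne_top hA) ?_
      exact (ENNReal.div_pos (ENNReal.coe_pos.2 hε).ne' hKtop).ne'
    unfold W2sq at hlt
    simp only [iInf_lt_iff] at hlt
    obtain ⟨π, hπ1, hπ2, hπ⟩ := hlt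
    have hdef := lintegral_defect_le (π := π) (x := x) ht hA
      ((lintegral_map_fst hπ1 (measurable_edist_sq x)).trans h1) hπ.le
      (lintegral_map_snd hπ2 (measurable_edist_sq x))
    have hind : ∀ᵐ p ∂π, E.indicator (fun _ => ENNReal.ofReal (δ ^ 2)) p.1 ≤
        2 * ENNReal.ofReal (defect x t p) := by
      filter_upwards [ae_of_map_snd hπ2 hsupp] with p hp
      by_cases hpE : p.1 ∈ E
      · rw [Set.indicator_of_mem hpE, ← ENNReal.ofReal_ofNat, ← ENNReal.ofReal_mul (by norm_num)]
        refine ENNReal.ofReal_le_ofReal ?_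
        have hpE' : η ≤ |dist x p.1 - t * d| := hpE
        have a1 : |dist x p.1 - t * d| ≤ |dist x p.1 - t * dist x p.2| + t * |dist x p.2 - d| := by
          have : dist x p.1 - t * d = (dist x p.1 - t * dist x p.2) + t * (dist x p.2 - d) := by
            ring
          rw [this]
          refine (abs_add_le _ _).trans ?_
          rw [abs_mul, abs_of_pos ht0]
        have a2 : δ ≤ |dist x p.1 - t * dist x p.2| := by
          have := mul_le_mul_of_nonneg_left hp ht0.le
          linarith
        have a3 : δ ^ 2 ≤ (dist x p.1 - t * dist x p.2) ^ 2 := by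
          rw [← sq_abs (dist x p.1 - t * dist x p.2)]
          exact pow_le_pow_left₀ hδpos.le a2 2
        refine a3.trans ?_
        unfold defect
        set f := dist x p.1
        set g := dist p.1 p.2
        set h := dist x p.2
        have hprod : 0 < t * (1 - t) := mul_pos ht0 ht1
        have b1 : ((1 - t) * f - t * g) ^ 2 ≤ ((1 - t) * f - t * g) ^ 2 / (t * (1 - t)) := by
          rw [le_div_iff₀ hprod]
          have : t * (1 - t) ≤ 1 := by nlinarith
          exact mul_le_of_le_one_right (sq_nonneg _) this
        have b2 : f - t * h = ((1 - t) * f - t * g) + t * (f + g - h) := by ring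
        have b3 : (t * (f + g - h)) ^ 2 ≤ (f + g - h) ^ 2 := by
          rw [mul_pow]
          have : t ^ 2 ≤ 1 := by nlinarith [ht.2]
          exact mul_le_of_le_one_left (sq_nonneg _) this
        rw [b2]
        nlinarith [sq_nonneg (((1 - t) * f - t * g) - t * (f + g - h))]
      · rw [Set.indicator_of_notMem hpE]
        exact zero_le
    calc μ E * ENNReal.ofReal (δ ^ 2)
        = ∫⁻ z, E.indicator (fun _ => ENNReal.ofReal (δ ^ 2)) z ∂μ := by
          rw [lintegral_indicator_const hEm, mul_comm]
      _ = ∫⁻ p, E.indicator (fun _ => ENNReal.ofReal (δ ^ 2)) p.1 ∂π :=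
          (lintegral_map_fst hπ1 (measurable_const.indicator hEm)).symm
      _ ≤ ∫⁻ p, 2 * ENNReal.ofReal (defect x t p) ∂π := lintegral_mono_ae hind
      _ = 2 * ∫⁻ p, ENNReal.ofReal (defect x t p) ∂π :=
          lintegral_const_mul _ (measurable_defect x t).ennreal_ofReal
      _ ≤ 2 * (ENNReal.ofReal (1 - t)⁻¹ * (ε / K)) := by gcongr
      _ = K * (ε / K) := by rw [hK, mul_assoc]
      _ ≤ 0 + ε := by rw [ENNReal.mul_div_cancel hK0 hKtop, zero_add]
  have hE0 : μ E = 0 := by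
    rcases mul_eq_zero.1 hμE with h | h
    · exact h
    · exact absurd h (ENNReal.ofReal_pos.2 (by positivity)).ne'
  refine (measure_eq_zero_iff_ae_notMem.1 hE0).mono fun z hz => not_le.1 hz

end Wasserstein

section Entropy

variable [MeasurableSpace X]

theorem UnE_of_Ent_eq_top {n : ℝ} (hn : 0 < n) {μ m : Measure X} (h : Ent μ m = ⊤) :
    UnE n μ m = 0 := by
  unfold UnE
  rw [h, EReal.neg_top, EReal.coe_mul_bot_of_pos (inv_pos.2 hn), EReal.exp_bot]

theorem Ent_ne_top {μ m : Measure X} (h : Ent μ m ≠ ⊤) : μ ≪ m ∧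
    Integrable (fun x => (μ.rnDeriv m x).toReal * Real.log (μ.rnDeriv m x).toReal) m := by
  by_contra hcon
  exact h (if_neg hcon)

theorem Ent_eq_coe {μ m : Measure X} (hac : μ ≪ m) (hInt :
    Integrable (fun x => (μ.rnDeriv m x).toReal * Real.log (μ.rnDeriv m x).toReal) m) :
    Ent μ m =
      ((∫ x, (μ.rnDeriv m x).toReal * Real.log (μ.rnDeriv m x).toReal ∂m : ℝ) : EReal) :=
  if_pos ⟨hac, hInt⟩

/-- Jensen's inequality for the entropy. -/
theorem UnE_one_le_measure (μ m : Measure X) [IsProbabilityMeasure μ] [SigmaFinite m]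
    {A : Set X} (hA : MeasurableSet A) (hμA : ∀ᵐ x ∂μ, x ∈ A) : UnE 1 μ m ≤ m A := by
  by_cases htop : Ent μ m = ⊤
  · rw [UnE_of_Ent_eq_top one_pos htop]; exact zero_le
  obtain ⟨hac, hInt⟩ := Ent_ne_top htop
  rcases eq_or_ne (m A) ⊤ with hAtop | hAtop
  · rw [hAtop]; exact le_top
  have hA0 : m A ≠ 0 := by
    intro h0
    have h1 : μ A = 0 := hac h0
    have h2 : μ A = 1 := (prob_compl_eq_zero_iff hA).1 hμA
    simp [h1] at h2
  set M := (m A).toReal with hM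
  have hMpos : 0 < M := ENNReal.toReal_pos hA0 hAtop
  have hzero : ∀ᵐ x ∂m, x ∉ A → μ.rnDeriv m x = 0 := by
    have h1 : ∫⁻ x in Aᶜ, μ.rnDeriv m x ∂m = 0 := by
      rw [Measure.setLIntegral_rnDeriv hac]
      exact hμA
    rw [lintegral_eq_zero_iff (Measure.measurable_rnDeriv μ m)] at h1
    exact (ae_restrict_iff' hA.compl).1 h1
  have hpt : ∀ᵐ x ∂m, (1 - Real.log M) * (μ.rnDeriv m x).toReal - A.indicator (fun _ => M⁻¹) x ≤
      (μ.rnDeriv m x).toReal * Real.log (μ.rnDeriv m x).toReal := by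
    filter_upwards [hzero] with x hx
    by_cases hxA : x ∈ A
    · rw [Set.indicator_of_mem hxA]
      set u := (μ.rnDeriv m x).toReal
      have hu : 0 ≤ u := ENNReal.toReal_nonneg
      rcases hu.eq_or_lt with h0 | hpos
      · rw [← h0]; simp [hMpos.le]
      · have hlog := Real.log_le_sub_one_of_pos (div_pos (inv_pos.2 hMpos) hpos)
        rw [Real.log_div (inv_pos.2 hMpos).ne' hpos.ne', Real.log_inv] at hlog
        have h2 := mul_le_mul_of_nonneg_left hlog hpos.le
        have h3 : u * (M⁻¹ / u - 1) = M⁻¹ - u := by field_simp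
        rw [h3] at h2
        linarith
    · rw [Set.indicator_of_notMem hxA, hx hxA]
      simp
  have hint1 : Integrable (fun x => (1 - Real.log M) * (μ.rnDeriv m x).toReal) m :=
    Measure.integrable_toReal_rnDeriv.const_mul _
  have hint2 : Integrable (A.indicator (fun _ => M⁻¹)) m :=
    (integrable_indicator_iff hA).2 (integrableOn_const hAtop)
  have hmono := integral_mono_ae (hint1.sub hint2) hInt hpt
  have hval : ∫ x, (1 - Real.log M) * (μ.rnDeriv m x).toReal - A.indicator (fun _ => M⁻¹) x ∂m =
      - Real.log M := by
    rw [integral_sub hint1 hint2, integral_const_mul, Measure.integral_toReal_rnDeriv hac,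
      integral_indicator_const _ hA]
    simp only [measureReal_def, measure_univ, ENNReal.toReal_one, smul_eq_mul, mul_one, ← hM]
    rw [mul_inv_cancel₀ hMpos.ne']
    ring
  simp only [Pi.sub_apply] at hmono
  rw [hval] at hmono
  unfold UnE
  rw [Ent_eq_coe hac hInt, inv_one, EReal.coe_one, one_mul, ← EReal.coe_neg, EReal.exp_coe,
    ← ENNReal.ofReal_toReal hAtop, ← hM]
  refine ENNReal.ofReal_le_ofReal ?_
  rw [← Real.exp_log hMpos]
  exact Real.exp_le_exp.2 (by linarith)

theorem rnDeriv_cond (m : Measure X) [SigmaFinite m] {B : Set X} (hB : MeasurableSet B) :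
    (ProbabilityTheory.cond m B).rnDeriv m =ᵐ[m] B.indicator fun _ => (m B)⁻¹ := by
  have h : ProbabilityTheory.cond m B = m.withDensity (B.indicator fun _ => (m B)⁻¹) := by
    rw [withDensity_indicator hB, withDensity_const]
    rfl
  rw [h]
  exact Measure.rnDeriv_withDensity m (measurable_const.indicator hB)

theorem UnE_one_cond (m : Measure X) [SigmaFinite m] {B : Set X} (hB : MeasurableSet B)
    (h0 : m B ≠ 0) (htop : m B ≠ ⊤) :
    Ent (ProbabilityTheory.cond m B) m ≠ ⊤ ∧ UnE 1 (ProbabilityTheory.cond m B) m = m B := by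
  have hpos : 0 < (m B).toReal := ENNReal.toReal_pos h0 htop
  set M := (m B).toReal with hM
  have hae : (fun x => ((ProbabilityTheory.cond m B).rnDeriv m x).toReal *
      Real.log ((ProbabilityTheory.cond m B).rnDeriv m x).toReal) =ᵐ[m]
      B.indicator fun _ => M⁻¹ * Real.log M⁻¹ := by
    filter_upwards [rnDeriv_cond m hB] with x hx
    rw [hx]
    by_cases hxB : x ∈ B
    · simp [Set.indicator_of_mem hxB, ENNReal.toReal_inv, hM]
    · simp [Set.indicator_of_notMem hxB]
  have hInt : Integrable (B.indicator fun _ => M⁻¹ * Real.log M⁻¹) m :=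
    (integrable_indicator_iff hB).2 (integrableOn_const htop)
  have hE := Ent_eq_coe ProbabilityTheory.cond_absolutelyContinuous (hInt.congr hae.symm)
  refine ⟨by rw [hE]; exact EReal.coe_ne_top _, ?_⟩
  unfold UnE
  rw [hE, integral_congr_ae hae, integral_indicator_const _ hB, inv_one, EReal.coe_one, one_mul,
    ← EReal.coe_neg, EReal.exp_coe, measureReal_def, ← hM, smul_eq_mul, ← mul_assoc,
    mul_inv_cancel₀ hpos.ne', one_mul, Real.log_inv, neg_neg, Real.exp_log hpos, hM,
    ENNReal.ofReal_toReal htop]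

end Entropy

section Contraction

variable [MetricSpace X] [MeasurableSpace X]

theorem FiniteOnBounded.sigmaFinite [SecondCountableTopology X] {m : Measure X}
    (hm : FiniteOnBounded m) : SigmaFinite m := by
  have : IsLocallyFiniteMeasure m :=
    ⟨fun x => ⟨Metric.ball x 1, Metric.ball_mem_nhds x one_pos, hm _ Metric.isBounded_ball⟩⟩
  infer_instance

variable [BorelSpace X]

theorem OptGeoSet.map_zero {μ0 μ1 : Measure X} [SecondCountableTopology X]
    {ν : Measure (GeoSpace X)} (h : ν ∈ OptGeoSet μ0 μ1) :
    (ν.map fun γ => geval γ 0) = μ0 := by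
  rw [← h.2.1, Measure.map_map measurable_fst (measurable_geval_pair 0 1)]
  rfl

theorem OptGeoSet.map_one {μ0 μ1 : Measure X} [SecondCountableTopology X]
    {ν : Measure (GeoSpace X)} (h : ν ∈ OptGeoSet μ0 μ1) :
    (ν.map fun γ => geval γ 1) = μ1 := by
  rw [← h.2.2.1, Measure.map_map measurable_snd (measurable_geval_pair 0 1)]
  rfl

variable [CompleteSpace X] [SecondCountableTopology X]

/-- Under the measure contraction property, the set of intermediate points between `x` and a small
ball around `y` has at least the measure prescribed by the distortion coefficient. -/
theorem mul_measure_ball_le_measure_Zt {m : Measure X} (hm : FiniteOnBounded m)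
    {G : X → X → ℝ≥0∞} {n : ℝ} (hInterp : SupportsInterp m n) {b : ℝ → ℝ≥0∞ → ℝ≥0∞}
    (hMCP : MCP m G b) {x y : X} (hx : x ∈ mSupp m) (hy : y ∈ mSupp m) {t : ℝ}
    (ht : t ∈ Set.Ioo (0 : ℝ) 1) {r : ℝ} (hr : 0 < r) (hr2 : 2 * r < dist x y)
    (hr3 : 3 * r < (1 - t) * dist x y) {c : ℝ≥0∞}
    (hc : ∀ y' ∈ Metric.ball y r, c ≤ b t (G x y')) :
    c * m (Metric.ball y r) ≤ m (Zt t {x} (Metric.ball y r)) := by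
  have := hm.sigmaFinite
  rcases eq_or_ne c 0 with rfl | hc0
  · rw [zero_mul]; exact zero_le
  obtain ⟨ht0, ht1⟩ := ht
  set d := dist x y with hd
  set B := Metric.ball y r with hB
  have hBm : MeasurableSet B := Metric.isOpen_ball.measurableSet
  have hB0 : m B ≠ 0 := (hy r hr).ne'
  have hBtop : m B ≠ ⊤ := (hm _ Metric.isBounded_ball).ne
  set μ₁ := ProbabilityTheory.cond m B with hμ₁
  have hprob₁ : IsProbabilityMeasure μ₁ :=
    ProbabilityTheory.cond_isProbabilityMeasure_of_finite hB0 hBtop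
  obtain ⟨hEnt₁, hU₁⟩ := UnE_one_cond m hBm hB0 hBtop
  have hac₁ : μ₁ ≪ m := ProbabilityTheory.cond_absolutelyContinuous
  have haeB : ∀ᵐ y' ∂μ₁, y' ∈ B := ProbabilityTheory.ae_cond_mem hBm
  have hsupp₁ : mSupp μ₁ ⊆ Metric.closedBall y r :=
    mSupp_subset_of_ae Metric.isClosed_closedBall
      (haeB.mono fun z hz => Metric.ball_subset_closedBall hz)
  have hμ₁mem : μ₁ ∈ PbsStar m := ⟨⟨hprob₁, Metric.isBounded_closedBall.subset hsupp₁,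
    mSupp_subset_of_absolutelyContinuous hac₁⟩, hEnt₁⟩
  have hxμ₁ : x ∉ mSupp μ₁ := fun h => by
    have := hsupp₁ h
    rw [Metric.mem_closedBall] at this
    linarith
  obtain ⟨μ, hgeo, hμ0, hμ1, hineq⟩ := hMCP x hx μ₁ hμ₁mem hxμ₁
  have htI : t ∈ Set.Icc (0 : ℝ) 1 := ⟨ht0.le, ht1.le⟩
  have h0I : (0 : ℝ) ∈ Set.Icc (0 : ℝ) 1 := by simp
  have h1I : (1 : ℝ) ∈ Set.Icc (0 : ℝ) 1 := by simp
  have hprob : IsProbabilityMeasure (μ t) := hgeo.prob t htI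
  have hlow : c * m B ≤ UnE 1 (μ t) m := by
    refine le_trans ?_ (hineq t ⟨ht0, ht1⟩ 1 le_rfl)
    rw [hU₁]
    gcongr
    rw [inv_one, EReal.coe_one, one_mul, ← ENNReal.exp_log c, EReal.exp_le_exp_iff,
      ← eintegral_const μ₁ (ENNReal.log c)]
    exact eintegral_mono_ae (haeB.mono fun y' hy' => ENNReal.log_le_log (hc y' hy'))
  have hEnt : Ent (μ t) m ≠ ⊤ := fun htop => by
    rw [UnE_of_Ent_eq_top one_pos htop, nonpos_iff_eq_zero] at hlow
    exact (mul_ne_zero hc0 hB0) hlow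
  have hac : μ t ≪ m := (Ent_ne_top hEnt).1
  set A : ℝ≥0∞ := ∫⁻ y', edist x y' ^ 2 ∂μ₁ with hA
  have hAtop : A ≠ ⊤ := by
    refine ne_top_of_le_ne_top (b := ENNReal.ofReal (d + r) ^ 2)
      (ENNReal.pow_ne_top ENNReal.ofReal_ne_top) ?_
    calc A ≤ ∫⁻ _, ENNReal.ofReal (d + r) ^ 2 ∂μ₁ := by
          refine lintegral_mono_ae (haeB.mono fun y' hy' => ?_)
          rw [edist_dist]
          gcongr
          have h1 := dist_triangle x y y'
          have h2 : dist y' y < r := hy'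
          rw [dist_comm] at h2
          linarith
      _ = _ := by simp
  have hW1 : W2sq (μ 0) (μ 1) = A := by rw [hμ0, hμ1, W2sq_dirac]
  have hfst : ∫⁻ z, edist x z ^ 2 ∂(μ t) = ENNReal.ofReal (t ^ 2) * A := by
    have h := hgeo.geo 0 h0I t htI
    rw [hW1, hμ0, W2sq_dirac] at h
    rw [h]
    congr 2
    ring
  have hsnd : W2sq (μ t) μ₁ = ENNReal.ofReal ((1 - t) ^ 2) * A := by
    have h := hgeo.geo t htI 1 h1I
    rw [hW1, hμ1] at h
    rw [h]
    congr 2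
    ring
  have hae : ∀ᵐ z ∂(μ t), |dist x z - t * d| < 2 * (t * r) := by
    refine ae_abs_dist_sub_lt (r := r) ⟨ht0, ht1⟩ hAtop hfst hsnd ?_ ?_
    · filter_upwards [haeB] with y' hy'
      have h1 := abs_dist_sub_le y' y x
      have h2 : dist y' y < r := hy'
      rw [dist_comm x y', hd, dist_comm x y]
      linarith
    · nlinarith [mul_pos ht0 hr]
  have hsupp : ∀ z ∈ mSupp (μ t), |dist x z - t * d| ≤ 2 * (t * r) := by
    refine mSupp_subset_of_ae ?_ (hae.mono fun z hz => hz.le)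
    exact isClosed_le ((continuous_const.dist continuous_id).sub continuous_const).abs
      continuous_const
  have hμtmem : μ t ∈ PbsStar m := by
    refine ⟨⟨hprob, (Metric.isBounded_closedBall (x := x) (r := t * d + 2 * (t * r))).subset ?_,
      mSupp_subset_of_absolutelyContinuous hac⟩, hEnt⟩
    intro z hz
    have h := (abs_le.1 (hsupp z hz)).2
    rw [Metric.mem_closedBall, dist_comm]
    linarith
  have hdisj : mSupp (μ t) ∩ mSupp μ₁ = ∅ := by
    refine Set.eq_empty_of_forall_notMem fun z hz => ?_
    have h1 := (abs_le.1 (hsupp z hz.1)).2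
    have h2 := hsupp₁ hz.2
    rw [Metric.mem_closedBall] at h2
    have h3 := dist_triangle x z y
    nlinarith
  obtain ⟨ν, hν, -⟩ := hInterp (μ t) hμtmem.1 μ₁ hμ₁mem hdisj
  have hνprob : IsProbabilityMeasure ν := hν.1
  have haligned : ∀ᵐ γ ∂ν, dist x (geval γ 0) = t * dist x (geval γ 1) ∧
      dist (geval γ 0) (geval γ 1) = (1 - t) * dist x (geval γ 1) := by
    have h := ae_aligned (π := ν.map fun γ => (geval γ 0, geval γ 1)) (x := x) ⟨ht0, ht1⟩ hAtop
      ((lintegral_map_fst hν.2.1 (measurable_edist_sq x)).trans hfst)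
      (hν.2.2.2.trans hsnd).le (lintegral_map_snd hν.2.2.1 (measurable_edist_sq x))
    exact ae_of_ae_map (measurable_geval_pair 0 1).aemeasurable h
  have hend : ∀ᵐ γ ∂ν, geval γ 1 ∈ B := by
    refine ae_of_ae_map (p := fun z => z ∈ B) (measurable_geval 1).aemeasurable ?_
    rw [OptGeoSet.map_one hν]
    exact haeB
  have hS := ae_exists_geodesic ν 0 (haligned.and hend)
  rw [OptGeoSet.map_zero hν] at hS
  have hdirac : mSupp (Measure.dirac x) ⊆ {x} := by
    refine mSupp_subset_of_ae isClosed_singleton ?_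
    rw [ae_dirac_eq]
    rfl
  have hxmem : Measure.dirac x ∈ Pbs m :=
    ⟨inferInstance, Bornology.isBounded_singleton.subset hdirac,
      hdirac.trans (Set.singleton_subset_iff.2 hx)⟩
  have hdisj' : mSupp (Measure.dirac x) ∩ mSupp (μ t) = ∅ := by
    refine Set.eq_empty_of_forall_notMem fun z hz => ?_
    have h0 : z = x := hdirac hz.1
    have h1 := (abs_le.1 (hsupp z hz.2)).1
    rw [h0, dist_self] at h1
    nlinarith
  obtain ⟨ν', hν', -⟩ := hInterp (Measure.dirac x) hxmem (μ t) hμtmem hdisj'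
  have hν'prob : IsProbabilityMeasure ν' := hν'.1
  have hstart : ∀ᵐ γ ∂ν', geval γ 0 = x := by
    refine ae_of_ae_map (p := fun z => z = x) (measurable_geval 0).aemeasurable ?_
    rw [OptGeoSet.map_zero hν', ae_dirac_eq]
    rfl
  have hT := ae_exists_geodesic ν' 1 hstart
  rw [OptGeoSet.map_one hν'] at hT
  have hZ : ∀ᵐ z ∂(μ t), z ∈ toMeasurable m (Zt t {x} B) := by
    filter_upwards [hS, hT] with z hz1 hz2
    obtain ⟨γ₂, ⟨⟨ha, ha'⟩, hb⟩, hz⟩ := hz1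
    obtain ⟨γ₁, hs, hz'⟩ := hz2
    obtain ⟨γ, h0, h1, h2⟩ := exists_geodesic_concat ⟨ht0, ht1⟩ γ₁ γ₂ (hz'.trans hz.symm)
      (by rw [hs, hz', ← hz, ha]) (by rw [hs, ha'])
    exact subset_toMeasurable _ _ ⟨γ, by rw [h0, hs]; rfl, by rw [h1]; exact hb, h2.trans hz'⟩
  calc c * m B ≤ UnE 1 (μ t) m := hlow
    _ ≤ m (toMeasurable m (Zt t {x} B)) :=
      UnE_one_le_measure _ _ (measurableSet_toMeasurable _ _) hZ
    _ = m (Zt t {x} B) := measure_toMeasurable _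

theorem le_trueBeta {m : Measure X} (hm : FiniteOnBounded m)
    {G : X → X → ℝ≥0∞} {n : ℝ} (hInterp : SupportsInterp m n) {b : ℝ → ℝ≥0∞ → ℝ≥0∞}
    (hMCP : MCP m G b) {t : ℝ} (ht : t ∈ Set.Ioo (0 : ℝ) 1) (hb : LowerSemicontinuous (b t))
    {x y : X} (hx : x ∈ mSupp m) (hy : y ∈ mSupp m) (hxy : x ≠ y)
    (hG : ContinuousAt (fun p : X × X => G p.1 p.2) (x, y)) :
    b t (G x y) ≤ trueBeta m t x y := by
  refine le_of_forall_lt_imp_le_of_dense fun c hc => ?_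
  have hGy : ContinuousAt (fun y' => G x y') y :=
    ContinuousAt.comp (f := fun y' : X => (x, y')) hG (by fun_prop)
  have hev : ∀ᶠ y' in 𝓝 y, c < b t (G x y') := hGy.eventually (hb (G x y) c hc)
  obtain ⟨r₀, hr₀, hball⟩ := Metric.eventually_nhds_iff_ball.1 hev
  have hdpos : 0 < dist x y := dist_pos.2 hxy
  have ht1 : 0 < 1 - t := sub_pos.2 ht.2
  refine Filter.le_limsup_of_frequently_le' (Filter.Eventually.frequently ?_)
  have hsmall : ∀ a : ℝ, 0 < a → ∀ᶠ r in 𝓝[>] (0 : ℝ), r < a := fun a ha =>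
    nhdsWithin_le_nhds (gt_mem_nhds ha)
  filter_upwards [self_mem_nhdsWithin, hsmall r₀ hr₀, hsmall (dist x y / 2) (by positivity),
    hsmall ((1 - t) * dist x y / 3) (by positivity)] with r hr h1 h2 h3
  have hB0 : m (Metric.ball y r) ≠ 0 := (hy r hr).ne'
  have hBtop : m (Metric.ball y r) ≠ ⊤ := (hm _ Metric.isBounded_ball).ne
  rw [ENNReal.le_div_iff_mul_le (Or.inl hB0) (Or.inl hBtop)]
  exact mul_measure_ball_le_measure_Zt hm hInterp hMCP hx hy ht hr (by linarith) (by linarith)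
    fun y' hy' => (hball y' (Metric.ball_subset_ball h1.le hy')).le

end Contraction

section Integration

theorem exists_measurable_eq_of_continuousAt {Y : Type*} [TopologicalSpace Y] [MeasurableSpace Y]
    [OpensMeasurableSpace Y] (F : Y → ℝ≥0∞) :
    ∃ H : Y → ℝ≥0∞, Measurable H ∧ ∀ y, ContinuousAt F y → H y = F y := by
  refine ⟨fun y => ⨆ (U : Set Y) (_ : IsOpen U) (_ : y ∈ U), ⨅ z ∈ U, F z, ?_, fun y hy => ?_⟩
  · refine LowerSemicontinuous.measurable fun y c hc => ?_
    simp only [lt_iSup_iff] at hc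
    obtain ⟨U, hU, hyU, hc⟩ := hc
    filter_upwards [hU.mem_nhds hyU] with z hz
    exact hc.trans_le (le_iSup_of_le U (le_iSup_of_le hU (le_iSup_of_le hz le_rfl)))
  · refine le_antisymm (iSup_le fun U => iSup_le fun _ => iSup_le fun hyU => iInf₂_le y hyU) ?_
    refine le_of_forall_lt_imp_le_of_dense fun c hc => ?_
    obtain ⟨U, hUsub, hU, hyU⟩ := mem_nhds_iff.1 (hy.eventually (lt_mem_nhds hc))
    refine le_iSup_of_le U (le_iSup_of_le hU (le_iSup_of_le hyU ?_))
    exact le_iInf₂ fun z hz => le_of_lt (hUsub hz)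

variable {Ω : Type*} [MeasurableSpace Ω]

/-- A function whose logarithm is bounded above by an integrable function either has a logarithmic
integral equal to `⊥`, or has an integrable logarithm. -/
theorem exists_integrable_log_of_eintegral_ne_bot {ν : Measure Ω} {u : Ω → ℝ≥0∞}
    (hu : AEMeasurable u ν) {h : Ω → ℝ} (hh : Integrable h ν)
    (hle : ∀ᵐ ω ∂ν, ENNReal.log (u ω) ≤ (h ω : EReal))
    (hbot : eintegral ν (fun ω => ENNReal.log (u ω)) ≠ ⊥) :
    ∃ L : Ω → ℝ, Integrable L ν ∧ (∀ᵐ ω ∂ν, u ω = ENNReal.ofReal (Real.exp (L ω))) ∧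
      eintegral ν (fun ω => ENNReal.log (u ω)) = ((∫ ω, L ω ∂ν : ℝ) : EReal) := by
  set L : Ω → ℝ := fun ω => (ENNReal.log (u ω)).toReal with hL
  have hlog : AEMeasurable (fun ω => ENNReal.log (u ω)) ν :=
    ENNReal.measurable_log.comp_aemeasurable hu
  have hLm : AEMeasurable L ν := hlog.ereal_toReal
  have hpos : ∫⁻ ω, epos (ENNReal.log (u ω)) ∂ν ≠ ⊤ := by
    refine ne_top_of_le_ne_top hh.lintegral_lt_top.ne (lintegral_mono_ae (hle.mono fun ω hω => ?_))
    rw [← epos_coe]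
    exact epos_mono hω
  have hneg : ∫⁻ ω, epos (-ENNReal.log (u ω)) ∂ν ≠ ⊤ := by
    intro htop
    apply hbot
    unfold eintegral
    rw [htop, EReal.coe_ennreal_top, EReal.sub_top]
  have hm : Measurable epos := epos_mono.measurable
  have hfin : ∀ᵐ ω ∂ν, epos (-ENNReal.log (u ω)) < ⊤ :=
    ae_lt_top' (hm.comp_aemeasurable hlog.neg) hneg
  have hcoe : ∀ᵐ ω ∂ν, ENNReal.log (u ω) = (L ω : EReal) := by
    filter_upwards [hle, hfin] with ω h1 h2
    refine (EReal.coe_toReal (h1.trans_lt (EReal.coe_lt_top _)).ne fun h => ?_).symm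
    rw [h] at h2
    simp [epos] at h2
  have hLint : Integrable L ν := by
    refine ⟨hLm.aestronglyMeasurable, ?_⟩
    rw [hasFiniteIntegral_iff_norm]
    calc ∫⁻ ω, ENNReal.ofReal ‖L ω‖ ∂ν
        ≤ ∫⁻ ω, (epos (ENNReal.log (u ω)) + epos (-ENNReal.log (u ω))) ∂ν := by
          refine lintegral_mono_ae (hcoe.mono fun ω hω => ?_)
          rw [hω, ← EReal.coe_neg, epos_coe, epos_coe, Real.norm_eq_abs]
          rcases abs_cases (L ω) with ⟨h1, -⟩ | ⟨h1, -⟩ <;> rw [h1]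
          · exact le_self_add
          · exact le_add_self
      _ = ∫⁻ ω, epos (ENNReal.log (u ω)) ∂ν + ∫⁻ ω, epos (-ENNReal.log (u ω)) ∂ν :=
          lintegral_add_left' (hm.comp_aemeasurable hlog) _
      _ < ⊤ := ENNReal.add_lt_top.2 ⟨hpos.lt_top, hneg.lt_top⟩
  refine ⟨L, hLint, hcoe.mono fun ω hω => ?_, ?_⟩
  · rw [← EReal.exp_coe, ← hω, ENNReal.exp_log]
  · rw [← eintegral_coe hLint]
    exact le_antisymm (eintegral_mono_ae (hcoe.mono fun ω hω => hω.le))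
      (eintegral_mono_ae (hcoe.mono fun ω hω => hω.ge))

theorem rpow_mul_ofReal_exp (n a p : ℝ) :
    ENNReal.ofReal (Real.exp a) ^ (1 / n) * ENNReal.ofReal (Real.exp (n⁻¹ * p)) =
      ENNReal.ofReal (Real.exp (n⁻¹ * (a + p))) := by
  rw [ENNReal.ofReal_rpow_of_pos (Real.exp_pos _), ← ENNReal.ofReal_mul (by positivity),
    ← Real.exp_mul, ← Real.exp_add]
  congr 2
  ring

theorem exists_log_of_rpow_mul_le {n : ℝ} (hn : 0 < n) {ν : Measure Ω} {u : Ω → ℝ≥0∞}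
    (hu : AEMeasurable u ν) {p r : Ω → ℝ} (hp : Integrable p ν)
    (hr : Integrable (fun ω => max (r ω) 0) ν)
    (hle : ∀ᵐ ω ∂ν, u ω ^ (1 / n) * ENNReal.ofReal (Real.exp (n⁻¹ * p ω)) ≤
      ENNReal.ofReal (Real.exp (n⁻¹ * r ω))) :
    EReal.exp (((n⁻¹ : ℝ) : EReal) * eintegral ν fun ω => ENNReal.log (u ω)) = 0 ∨
    ∃ L : Ω → ℝ, Integrable L ν ∧ (∀ᵐ ω ∂ν, u ω = ENNReal.ofReal (Real.exp (L ω))) ∧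
      EReal.exp (((n⁻¹ : ℝ) : EReal) * eintegral ν fun ω => ENNReal.log (u ω)) =
        ENNReal.ofReal (Real.exp (n⁻¹ * ∫ ω, L ω ∂ν)) := by
  by_cases hbot : eintegral ν (fun ω => ENNReal.log (u ω)) = ⊥
  · left
    rw [hbot, EReal.coe_mul_bot_of_pos (inv_pos.2 hn), EReal.exp_bot]
  · right
    have hlog : ∀ᵐ ω ∂ν, ENNReal.log (u ω) ≤ ((max (r ω) 0 - p ω : ℝ) : EReal) := by
      filter_upwards [hle] with ω hω
      have hfin : u ω ≠ ⊤ := by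
        intro h
        rw [h, ENNReal.top_rpow_of_pos (by positivity), ENNReal.top_mul (by positivity)] at hω
        exact absurd hω (by simp)
      rw [← EReal.exp_le_exp_iff, ENNReal.exp_log, EReal.exp_coe]
      rcases eq_or_ne (u ω) 0 with h0 | h0
      · rw [h0]; exact zero_le
      have hpos : 0 < (u ω).toReal := ENNReal.toReal_pos h0 hfin
      have hval : u ω = ENNReal.ofReal (Real.exp (Real.log (u ω).toReal)) := by
        rw [Real.exp_log hpos, ENNReal.ofReal_toReal hfin]
      rw [hval, rpow_mul_ofReal_exp, ENNReal.ofReal_le_ofReal_iff (Real.exp_pos _).le,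
        Real.exp_le_exp, mul_le_mul_iff_of_pos_left (inv_pos.2 hn)] at hω
      rw [hval]
      gcongr
      have := le_max_left (r ω) 0
      linarith
    obtain ⟨L, hL, hLu, hLint⟩ := exists_integrable_log_of_eintegral_ne_bot hu (hr.sub hp) hlog hbot
    refine ⟨L, hL, hLu, ?_⟩
    rw [hLint, ← EReal.coe_mul, EReal.exp_coe]

theorem integrable_of_le_of_integrable_max {ν : Measure Ω} {a r : Ω → ℝ} (ha : Integrable a ν)
    (hrm : AEMeasurable r ν) (hr : Integrable (fun ω => max (r ω) 0) ν) (hle : ∀ᵐ ω ∂ν, a ω ≤ r ω) :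
    Integrable r ν := by
  refine (ha.norm.add hr).mono' hrm.aestronglyMeasurable (hle.mono fun ω hω => ?_)
  simp only [Real.norm_eq_abs, Pi.add_apply]
  rcases le_total 0 (r ω) with h | h
  · rw [abs_of_nonneg h, max_eq_left h]
    linarith [abs_nonneg (a ω)]
  · rw [abs_of_nonpos h, max_eq_right h]
    linarith [neg_le_abs (a ω)]

theorem ofReal_exp_integral_le {n : ℝ} (hn : 0 < n) {ν : Measure Ω} {a p r : Ω → ℝ}
    (ha : Integrable a ν) (hp : Integrable p ν) (hr : Integrable r ν)
    (hle : ∀ᵐ ω ∂ν, a ω + p ω ≤ r ω) :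
    ENNReal.ofReal (Real.exp (n⁻¹ * ∫ ω, a ω ∂ν)) * ENNReal.ofReal (Real.exp (n⁻¹ * ∫ ω, p ω ∂ν)) ≤
      ENNReal.ofReal (Real.exp (n⁻¹ * ∫ ω, r ω ∂ν)) := by
  rw [← ENNReal.ofReal_mul (by positivity), ← Real.exp_add, ← mul_add, ← integral_add ha hp]
  exact ENNReal.ofReal_le_ofReal (Real.exp_le_exp.2 (mul_le_mul_of_nonneg_left
    (integral_mono_ae (ha.add hp) hr hle) (inv_nonneg.2 hn.le)))

/-- The tangent plane inequality for the convex function `(a, b) ↦ log (exp a + exp b)`. -/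
theorem add_le_log_exp_add_exp (a b A B : ℝ) :
    Real.exp A / (Real.exp A + Real.exp B) * (a - A) +
      Real.exp B / (Real.exp A + Real.exp B) * (b - B) + Real.log (Real.exp A + Real.exp B) ≤
      Real.log (Real.exp a + Real.exp b) := by
  set S := Real.exp A + Real.exp B with hS
  have hSpos : 0 < S := by positivity
  set l := Real.exp A / S with hl
  set k := Real.exp B / S with hk
  have hlk : l + k = 1 := by rw [hl, hk, ← add_div, ← hS, div_self hSpos.ne']
  have hconv := convexOn_exp.2 (Set.mem_univ (a - A)) (Set.mem_univ (b - B))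
    (by positivity : 0 ≤ l) (by positivity : 0 ≤ k) hlk
  simp only [smul_eq_mul] at hconv
  have hval : l * Real.exp (a - A) + k * Real.exp (b - B) = (Real.exp a + Real.exp b) / S := by
    rw [Real.exp_sub, Real.exp_sub, hl, hk]
    field_simp
  rw [hval] at hconv
  have h := Real.log_le_log (Real.exp_pos _) hconv
  rw [Real.log_exp, Real.log_div (by positivity) hSpos.ne'] at h
  linarith

theorem exp_integral_add_exp_integral_le {n : ℝ} {ν : Measure Ω}
    [IsProbabilityMeasure ν] {a b r : Ω → ℝ} (ha : Integrable a ν) (hb : Integrable b ν)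
    (hr : Integrable r ν)
    (hle : ∀ᵐ ω ∂ν, Real.exp (n⁻¹ * a ω) + Real.exp (n⁻¹ * b ω) ≤ Real.exp (n⁻¹ * r ω)) :
    Real.exp (n⁻¹ * ∫ ω, a ω ∂ν) + Real.exp (n⁻¹ * ∫ ω, b ω ∂ν) ≤
      Real.exp (n⁻¹ * ∫ ω, r ω ∂ν) := by
  set A := n⁻¹ * ∫ ω, a ω ∂ν with hA
  set B := n⁻¹ * ∫ ω, b ω ∂ν with hB
  set l := Real.exp A / (Real.exp A + Real.exp B)
  set k := Real.exp B / (Real.exp A + Real.exp B)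
  have hpt : ∀ᵐ ω ∂ν, l * (n⁻¹ * a ω - A) + k * (n⁻¹ * b ω - B) +
      Real.log (Real.exp A + Real.exp B) ≤ n⁻¹ * r ω := by
    filter_upwards [hle] with ω hω
    refine (add_le_log_exp_add_exp _ _ A B).trans ?_
    rw [← Real.log_exp (n⁻¹ * r ω)]
    exact Real.log_le_log (by positivity) hω
  have hia : Integrable (fun ω => l * (n⁻¹ * a ω - A)) ν :=
    ((ha.const_mul _).sub (integrable_const _)).const_mul _
  have hib : Integrable (fun ω => k * (n⁻¹ * b ω - B)) ν :=
    ((hb.const_mul _).sub (integrable_const _)).const_mul _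
  have hiab : Integrable (fun ω => l * (n⁻¹ * a ω - A) + k * (n⁻¹ * b ω - B)) ν := hia.add hib
  have hInt := integral_mono_ae (hiab.add (integrable_const _)) (hr.const_mul n⁻¹) hpt
  have hA0 : ∫ ω, n⁻¹ * a ω - A ∂ν = 0 := by
    rw [integral_sub (ha.const_mul _) (integrable_const _), integral_const_mul]
    simp [hA]
  have hB0 : ∫ ω, n⁻¹ * b ω - B ∂ν = 0 := by
    rw [integral_sub (hb.const_mul _) (integrable_const _), integral_const_mul]
    simp [hB]
  simp only [Pi.add_apply] at hInt
  rw [integral_add hiab (integrable_const _), integral_add hia hib, integral_const_mul,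
    integral_const_mul, hA0, hB0, integral_const_mul] at hInt
  simp only [integral_const, probReal_univ, one_smul, mul_zero, zero_add] at hInt
  calc Real.exp A + Real.exp B = Real.exp (Real.log (Real.exp A + Real.exp B)) :=
        (Real.exp_log (by positivity)).symm
    _ ≤ _ := Real.exp_le_exp.2 hInt

/-- Integration of a pointwise interpolation inequality. -/
theorem exp_eintegral_log_add_le {n : ℝ} (hn : 0 < n) {ν : Measure Ω}
    [IsProbabilityMeasure ν] {u v : Ω → ℝ≥0∞} (hu : AEMeasurable u ν) (hv : AEMeasurable v ν)
    {p q r : Ω → ℝ} (hp : Integrable p ν) (hq : Integrable q ν) (hrm : AEMeasurable r ν)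
    (hr : Integrable (fun ω => max (r ω) 0) ν) {E : ℝ≥0∞}
    (hE : Integrable r ν → E = ENNReal.ofReal (Real.exp (n⁻¹ * ∫ ω, r ω ∂ν)))
    (hle : ∀ᵐ ω ∂ν, u ω ^ (1 / n) * ENNReal.ofReal (Real.exp (n⁻¹ * p ω)) +
      v ω ^ (1 / n) * ENNReal.ofReal (Real.exp (n⁻¹ * q ω)) ≤
      ENNReal.ofReal (Real.exp (n⁻¹ * r ω))) :
    EReal.exp (((n⁻¹ : ℝ) : EReal) * eintegral ν fun ω => ENNReal.log (u ω)) *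
        ENNReal.ofReal (Real.exp (n⁻¹ * ∫ ω, p ω ∂ν)) +
      EReal.exp (((n⁻¹ : ℝ) : EReal) * eintegral ν fun ω => ENNReal.log (v ω)) *
        ENNReal.ofReal (Real.exp (n⁻¹ * ∫ ω, q ω ∂ν)) ≤ E := by
  have hn' : 0 < n⁻¹ := inv_pos.2 hn
  have key : ∀ {w : Ω → ℝ≥0∞} {L k : Ω → ℝ}, (∀ᵐ ω ∂ν, w ω = ENNReal.ofReal (Real.exp (L ω))) →
      (∀ᵐ ω ∂ν, w ω ^ (1 / n) * ENNReal.ofReal (Real.exp (n⁻¹ * k ω)) ≤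
        ENNReal.ofReal (Real.exp (n⁻¹ * r ω))) → ∀ᵐ ω ∂ν, L ω + k ω ≤ r ω := by
    intro w L k h1 h2
    filter_upwards [h1, h2] with ω h1 h2
    rwa [h1, rpow_mul_ofReal_exp, ENNReal.ofReal_le_ofReal_iff (Real.exp_pos _).le,
      Real.exp_le_exp, mul_le_mul_iff_of_pos_left hn'] at h2
  have hleu := hle.mono fun ω hω => le_self_add.trans hω
  have hlev := hle.mono fun ω hω => le_add_self.trans hω
  rcases exists_log_of_rpow_mul_le hn hu hp hr hleu with hu0 | ⟨L, hL, hLu, hLe⟩ <;>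
    rcases exists_log_of_rpow_mul_le hn hv hq hr hlev with hv0 | ⟨M, hM, hMv, hMe⟩
  · rw [hu0, hv0]
    simp
  · have hb := key hMv hlev
    have hri := integrable_of_le_of_integrable_max (hM.add hq) hrm hr hb
    rw [hu0, zero_mul, zero_add, hMe, hE hri]
    exact ofReal_exp_integral_le hn hM hq hri hb
  · have hb := key hLu hleu
    have hri := integrable_of_le_of_integrable_max (hL.add hp) hrm hr hb
    rw [hv0, zero_mul, add_zero, hLe, hE hri]
    exact ofReal_exp_integral_le hn hL hp hri hb
  · have hri := integrable_of_le_of_integrable_max (hL.add hp) hrm hr (key hLu hleu)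
    have hboth : ∀ᵐ ω ∂ν, Real.exp (n⁻¹ * (L + p) ω) + Real.exp (n⁻¹ * (M + q) ω) ≤
        Real.exp (n⁻¹ * r ω) := by
      filter_upwards [hle, hLu, hMv] with ω h1 h2 h3
      rwa [h2, h3, rpow_mul_ofReal_exp, rpow_mul_ofReal_exp,
        ← ENNReal.ofReal_add (Real.exp_pos _).le (Real.exp_pos _).le,
        ENNReal.ofReal_le_ofReal_iff (Real.exp_pos _).le] at h1
    have hfin := exp_integral_add_exp_integral_le (hL.add hp) (hM.add hq) hri hboth
    rw [integral_add' hL hp, integral_add' hM hq, mul_add, mul_add, Real.exp_add,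
      Real.exp_add] at hfin
    rw [hLe, hMe, hE hri, ← ENNReal.ofReal_mul (Real.exp_pos _).le,
      ← ENNReal.ofReal_mul (Real.exp_pos _).le,
      ← ENNReal.ofReal_add (by positivity) (by positivity)]
    exact ENNReal.ofReal_le_ofReal hfin

end Integration

section LogLikelihood

variable {Ω : Type*} [MeasurableSpace Ω] [MeasurableSpace X] {ν : Measure Ω} {μ m : Measure X}
  [IsProbabilityMeasure μ] [SigmaFinite m] {e : Ω → X}

theorem integrable_neg_llr_of_Ent_ne_top (he : Measurable e) (hmap : ν.map e = μ)
    (hEnt : Ent μ m ≠ ⊤) : Integrable (fun ω => -llr μ m (e ω)) ν := by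
  obtain ⟨hac, hInt⟩ := Ent_ne_top hEnt
  have h := (integrable_rnDeriv_mul_log_iff hac).1 hInt
  nth_rewrite 2 [← hmap] at h
  exact ((integrable_map_measure (measurable_llr μ m).aestronglyMeasurable he.aemeasurable).1 h).neg

theorem UnE_eq_of_integrable_neg_llr (n : ℝ) (he : Measurable e) (hmap : ν.map e = μ)
    (hac : μ ≪ m) (hInt : Integrable (fun ω => -llr μ m (e ω)) ν) :
    UnE n μ m = ENNReal.ofReal (Real.exp (n⁻¹ * ∫ ω, -llr μ m (e ω) ∂ν)) := by
  have hmeas : AEStronglyMeasurable (llr μ m) (ν.map e) :=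
    (measurable_llr μ m).aestronglyMeasurable
  have h1 : Integrable (llr μ m) μ := by
    have h := (integrable_map_measure hmeas he.aemeasurable).2
      (by simpa [Function.comp_def] using hInt.neg)
    rwa [hmap] at h
  have h2 : ∫ ω, llr μ m (e ω) ∂ν = ∫ x, llr μ m x ∂μ := by
    rw [← integral_map he.aemeasurable hmeas, hmap]
  unfold UnE
  rw [Ent_eq_coe hac ((integrable_rnDeriv_mul_log_iff hac).2 h1), integral_rnDeriv_mul_log hac,
    ← EReal.coe_neg, ← EReal.coe_mul, EReal.exp_coe, integral_neg, h2]

theorem ae_rnDeriv_rpow_eq (n : ℝ) (he : Measurable e) (hmap : ν.map e = μ) (hac : μ ≪ m) :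
    ∀ᵐ ω ∂ν, μ.rnDeriv m (e ω) ^ (-(1 / n)) =
      ENNReal.ofReal (Real.exp (n⁻¹ * -llr μ m (e ω))) := by
  refine ae_of_ae_map (p := fun x => μ.rnDeriv m x ^ (-(1 / n)) =
    ENNReal.ofReal (Real.exp (n⁻¹ * -llr μ m x))) he.aemeasurable ?_
  rw [hmap]
  filter_upwards [Measure.rnDeriv_pos hac, hac.ae_le (Measure.rnDeriv_lt_top μ m)] with x h0 h1
  have hpos := ENNReal.toReal_pos h0.ne' h1.ne
  rw [← ENNReal.ofReal_toReal h1.ne, ENNReal.ofReal_rpow_of_pos hpos, Real.rpow_def_of_pos hpos,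
    llr]
  congr 2
  ring

/-- The negative part of the logarithm of the density of a probability measure concentrated on a
set of finite reference measure is integrable. -/
theorem integrable_max_neg_llr (he : Measurable e) (hmap : ν.map e = μ) (hac : μ ≪ m) {S : Set X}
    (hS : MeasurableSet S) (hmS : m S ≠ ⊤) (hμS : ∀ᵐ x ∂μ, x ∈ S) :
    Integrable (fun ω => max (-llr μ m (e ω)) 0) ν := by
  have hmeas : Measurable fun x => max (-llr μ m x) 0 :=
    (measurable_llr μ m).neg.max measurable_const
  suffices h : Integrable (fun x => max (-llr μ m x) 0) μ by
    have hiff := integrable_map_measure (μ := ν) hmeas.aestronglyMeasurable he.aemeasurable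
    rw [hmap] at hiff
    exact hiff.1 h
  refine ⟨hmeas.aestronglyMeasurable, ?_⟩
  rw [hasFiniteIntegral_iff_ofReal (ae_of_all _ fun x => by simp)]
  calc ∫⁻ x, ENNReal.ofReal (max (-llr μ m x) 0) ∂μ
      = ∫⁻ x, S.indicator (fun x => ENNReal.ofReal (max (-llr μ m x) 0)) x ∂μ :=
        lintegral_congr_ae (hμS.mono fun x hx => by rw [Set.indicator_of_mem hx])
    _ = ∫⁻ x, μ.rnDeriv m x * S.indicator (fun x => ENNReal.ofReal (max (-llr μ m x) 0)) x ∂m :=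
        (lintegral_rnDeriv_mul hac (hmeas.ennreal_ofReal.indicator hS).aemeasurable).symm
    _ ≤ ∫⁻ x, S.indicator 1 x ∂m := by
        refine lintegral_mono_ae ((Measure.rnDeriv_lt_top μ m).mono fun x hx => ?_)
        by_cases hxS : x ∈ S
        · rw [Set.indicator_of_mem hxS, Set.indicator_of_mem hxS, Pi.one_apply]
          nth_rewrite 1 [← ENNReal.ofReal_toReal hx.ne]
          rw [← ENNReal.ofReal_mul ENNReal.toReal_nonneg, ENNReal.ofReal_le_one, llr]
          set a := (μ.rnDeriv m x).toReal
          have ha : 0 ≤ a := ENNReal.toReal_nonneg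
          rcases ha.eq_or_lt with h0 | hpos
          · rw [← h0, zero_mul]; exact zero_le_one
          rw [mul_max_of_nonneg _ _ ha, mul_zero]
          refine max_le ?_ zero_le_one
          have h1 := Real.log_le_sub_one_of_pos (inv_pos.2 hpos)
          rw [Real.log_inv] at h1
          calc a * -Real.log a ≤ a * (a⁻¹ - 1) := mul_le_mul_of_nonneg_left h1 ha
            _ = 1 - a := by field_simp
            _ ≤ 1 := by linarith
        · rw [Set.indicator_of_notMem hxS, Set.indicator_of_notMem hxS, mul_zero]
    _ = m S := lintegral_indicator_one hS
    _ < ⊤ := hmS.lt_top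

end LogLikelihood

section Main

variable [MetricSpace X] [MeasurableSpace X] [BorelSpace X]
  [SecondCountableTopology X]

theorem aemeasurable_beta_gauge {s : ℝ → ℝ} {N : ℝ} (hsN : DistortionData s N) {t : ℝ}
    (ht : 0 < t) {G : X → X → ℝ≥0∞} {ν : Measure (GeoSpace X)} {t₀ t₁ : ℝ}
    (hcont : ∀ᵐ γ ∂ν, ContinuousAt (fun p : X × X => G p.1 p.2) (geval γ t₀, geval γ t₁)) :
    AEMeasurable (fun γ => beta s N t (G (geval γ t₀) (geval γ t₁))) ν := by
  obtain ⟨H, hH, hHG⟩ := exists_measurable_eq_of_continuousAt fun p : X × X => G p.1 p.2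
  exact ⟨fun γ => beta s N t (H (geval γ t₀, geval γ t₁)),
    (hsN.measurable_beta ht).comp (hH.comp (measurable_geval_pair t₀ t₁)),
    hcont.mono fun γ hγ => congrArg (beta s N t) (hHG _ hγ).symm⟩

theorem ae_geval_mem_mSupp {μ0 μ1 : Measure X} {ν : Measure (GeoSpace X)}
    (hν : ν ∈ OptGeoSet μ0 μ1) : ∀ᵐ γ ∂ν, geval γ 0 ∈ mSupp μ0 ∧ geval γ 1 ∈ mSupp μ1 := by
  have hz : ∀ᵐ x ∂(ν.map fun γ => geval γ 0), x ∈ mSupp μ0 := by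
    rw [OptGeoSet.map_zero hν]
    exact ae_mem_mSupp μ0
  have ho : ∀ᵐ x ∂(ν.map fun γ => geval γ 1), x ∈ mSupp μ1 := by
    rw [OptGeoSet.map_one hν]
    exact ae_mem_mSupp μ1
  exact (ae_of_ae_map (measurable_geval 0).aemeasurable hz).and
    (ae_of_ae_map (measurable_geval 1).aemeasurable ho)

theorem exists_bounded_ae_mem_geval {μ0 μ1 : Measure X} (h0 : Bornology.IsBounded (mSupp μ0))
    (h1 : Bornology.IsBounded (mSupp μ1)) {ν : Measure (GeoSpace X)} (hν : ν ∈ OptGeoSet μ0 μ1)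
    {t : ℝ} (ht : t ∈ Set.Icc (0 : ℝ) 1) :
    ∃ S : Set X, MeasurableSet S ∧ Bornology.IsBounded S ∧
      ∀ᵐ x ∂(ν.map fun γ => geval γ t), x ∈ S := by
  have hprob : IsProbabilityMeasure ν := hν.1
  obtain ⟨γ₀⟩ := nonempty_of_isProbabilityMeasure ν
  set c := geval γ₀ 0
  obtain ⟨R, hR⟩ := (Metric.isBounded_iff_subset_closedBall c).1 (h0.union h1)
  have hSm : MeasurableSet (Metric.closedBall c (3 * R)) := Metric.isClosed_closedBall.measurableSet
  refine ⟨_, hSm, Metric.isBounded_closedBall, ?_⟩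
  refine (ae_map_iff (p := fun x => x ∈ Metric.closedBall c (3 * R))
    (measurable_geval t).aemeasurable hSm).2 ?_
  filter_upwards [ae_geval_mem_mSupp hν] with γ hγ
  have hz : dist (geval γ 0) c ≤ R := hR (Or.inl hγ.1)
  have ho : dist (geval γ 1) c ≤ R := hR (Or.inr hγ.2)
  have hd := dist_geval γ ht (by simp : (0 : ℝ) ∈ Set.Icc (0 : ℝ) 1)
  rw [sub_zero, abs_of_nonneg ht.1] at hd
  have h2 := dist_triangle_right (geval γ 0) (geval γ 1) c
  have h3 := dist_triangle (geval γ t) (geval γ 0) c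
  have h4 := mul_le_of_le_one_left (dist_nonneg (x := geval γ 0) (y := geval γ 1)) ht.2
  rw [Metric.mem_closedBall]
  linarith

end Main

/-- `MCP` implies `CD` for spaces supporting interpolation inequalities. -/
theorem mcp_to_cd {X : Type*} [MetricSpace X] [MeasurableSpace X]
    [BorelSpace X] [CompleteSpace X] [TopologicalSpace.SeparableSpace X]
    (m : Measure X) (hm : FiniteOnBounded m) (G : X → X → ℝ≥0∞)
    (n : ℝ) (hn : 1 ≤ n) (hInterp : SupportsInterp m n)
    (hcont : ∀ μ0 ∈ Pbs m, ∀ μ1 ∈ PbsStar m, mSupp μ0 ∩ mSupp μ1 = ∅ →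
      ∀ ν : Measure (GeoSpace X), IsInterpPlan m n μ0 μ1 ν →
        ν {γ | ¬ (ContinuousAt (fun p : X × X => G p.1 p.2) (geval γ 0, geval γ 1) ∧
            ContinuousAt (fun p : X × X => G p.1 p.2) (geval γ 1, geval γ 0))} = 0)
    (s : ℝ → ℝ) (N : ℝ) (hsN : DistortionData s N) (hNn : n ≤ N)
    (hMCP : MCP m G (beta s N)) :
    CD m G (beta s N) n := by
  have : SecondCountableTopology X := UniformSpace.secondCountable_of_separable X
  have := hm.sigmaFinite
  have hn0 : 0 < n := one_pos.trans_le hn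
  intro μ0 h0 μ1 h1 hdisj
  obtain ⟨ν, hplan⟩ := hInterp μ0 h0 μ1 h1 hdisj
  have hcontν : ∀ᵐ γ ∂ν, ContinuousAt (fun p : X × X => G p.1 p.2) (geval γ 0, geval γ 1) ∧
      ContinuousAt (fun p : X × X => G p.1 p.2) (geval γ 1, geval γ 0) :=
    hcont μ0 h0 μ1 h1 hdisj ν hplan
  obtain ⟨hν, hac, hineq⟩ := hplan
  refine ⟨ν, hν, fun t ht => ?_⟩
  have hνprob : IsProbabilityMeasure ν := hν.1
  have hprob0 : IsProbabilityMeasure μ0 := h0.1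
  have hprob1 : IsProbabilityMeasure μ1 := h1.1.1
  have ht' : 1 - t ∈ Set.Ioo (0 : ℝ) 1 := ⟨by linarith [ht.2], by linarith [ht.1]⟩
  set μt := ν.map fun γ => geval γ t with hμt
  have hprobt : IsProbabilityMeasure μt :=
    Measure.isProbabilityMeasure_map (measurable_geval t).aemeasurable
  have hact : μt ≪ m := hac t ⟨ht.1, ht.2.le⟩
  have hac1 : μ1 ≪ m := (Ent_ne_top h1.2).1
  have hmap0 := OptGeoSet.map_zero hν
  have hmap1 := OptGeoSet.map_one hν
  set u : GeoSpace X → ℝ≥0∞ := fun γ => beta s N (1 - t) (G (geval γ 1) (geval γ 0))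
  set v : GeoSpace X → ℝ≥0∞ := fun γ => beta s N t (G (geval γ 0) (geval γ 1))
  have hu : AEMeasurable u ν := aemeasurable_beta_gauge hsN ht'.1 (hcontν.mono fun γ h => h.2)
  have hv : AEMeasurable v ν := aemeasurable_beta_gauge hsN ht.1 (hcontν.mono fun γ h => h.1)
  have hle : ∀ᵐ γ ∂ν, u γ ≤ trueBeta m (1 - t) (geval γ 1) (geval γ 0) ∧
      v γ ≤ trueBeta m t (geval γ 0) (geval γ 1) := by
    filter_upwards [hcontν, ae_geval_mem_mSupp hν] with γ hc ⟨hz, ho⟩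
    have hne : geval γ 0 ≠ geval γ 1 := fun h =>
      Set.eq_empty_iff_forall_notMem.1 hdisj _ ⟨hz, h ▸ ho⟩
    exact ⟨le_trueBeta hm hInterp hMCP ht' (hsN.lowerSemicontinuous_beta ht'.1) (h1.1.2.2 ho)
        (h0.2.2 hz) hne.symm hc.2,
      le_trueBeta hm hInterp hMCP ht (hsN.lowerSemicontinuous_beta ht.1) (h0.2.2 hz)
        (h1.1.2.2 ho) hne hc.1⟩
  have hq := integrable_neg_llr_of_Ent_ne_top (measurable_geval 1) hmap1 h1.2
  have hU1 := UnE_eq_of_integrable_neg_llr n (measurable_geval 1) hmap1 hac1 hq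
  have hE := UnE_eq_of_integrable_neg_llr n (measurable_geval t) hμt.symm hact
  have hρ1 := ae_rnDeriv_rpow_eq n (measurable_geval 1) hmap1 hac1
  have hρt := ae_rnDeriv_rpow_eq n (measurable_geval t) hμt.symm hact
  have hrm : AEMeasurable (fun γ => -llr μt m (geval γ t)) ν :=
    ((measurable_llr μt m).comp (measurable_geval t)).neg.aemeasurable
  obtain ⟨S, hS, hSb, hμS⟩ := exists_bounded_ae_mem_geval h0.2.1 h1.1.2.1 hν ⟨ht.1.le, ht.2.le⟩
  have hr := integrable_max_neg_llr (measurable_geval t) hμt.symm hact hS (hm S hSb).ne hμS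
  have hdn : 0 ≤ 1 / n := by positivity
  unfold cdCoeff
  by_cases hEnt0 : Ent μ0 m = ⊤
  · rw [UnE_of_Ent_eq_top hn0 hEnt0, mul_zero, zero_add, hU1]
    refine le_trans le_add_self (exp_eintegral_log_add_le hn0 (u := fun _ => 0) (p := fun _ => 0)
      aemeasurable_const hv (integrable_zero _ _ _) hq hrm hr hE ?_)
    filter_upwards [hle, hρ1, hρt, hineq t ht] with γ hγ h1 ht hγineq
    rw [ENNReal.zero_rpow_of_pos (by positivity), zero_mul, zero_add, ← h1, ← ht]
    have hb : trueBeta m t (geval γ 0) (geval γ 1) ^ (1 / n)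
        * μ1.rnDeriv m (geval γ 1) ^ (-(1 / n)) ≤ μt.rnDeriv m (geval γ t) ^ (-(1 / n)) := by
      by_cases hac0 : μ0 ≪ m
      · exact le_add_self.trans (hγineq.1 hac0)
      · exact hγineq.2 hac0
    exact le_trans (mul_le_mul_left (ENNReal.rpow_le_rpow hγ.2 hdn) _) hb
  · have hac0 : μ0 ≪ m := (Ent_ne_top hEnt0).1
    have hp := integrable_neg_llr_of_Ent_ne_top (measurable_geval 0) hmap0 hEnt0
    rw [UnE_eq_of_integrable_neg_llr n (measurable_geval 0) hmap0 hac0 hp, hU1]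
    refine exp_eintegral_log_add_le hn0 hu hv hp hq hrm hr hE ?_
    filter_upwards [hle, ae_rnDeriv_rpow_eq n (measurable_geval 0) hmap0 hac0, hρ1, hρt,
      hineq t ht] with γ hγ h0 h1 ht hγineq
    rw [← h0, ← h1, ← ht]
    refine le_trans (add_le_add ?_ ?_) (hγineq.1 hac0)
    · exact mul_le_mul_left (ENNReal.rpow_le_rpow hγ.1 hdn) _
    · exact mul_le_mul_left (ENNReal.rpow_le_rpow hγ.2 hdn) _

end GMMS
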